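/- arXiv:2412.05326 — 7 statements merged into one kernel-verified Lean document; each statement's English description precedes it below -/
import Mathlib

section
/- (Krygin–Atkinson, integer-valued form) Let S be an ergodic measure-preserving invertible transformation of a probability space (X,μ) and let f : X → ℤ be integrable with ∫_X f dμ = 0. Then for μ-almost every x ∈ X the set {n ∈ ℕ : ∑_{i=0}^{n-1} f(Sⁱ x) = 0} is infinite. -/
open MeasureTheory Filter Topology

section MeanErgodic

variable {X : Type*} [MeasurableSpace X] {μ : Measure X} {S : X → X}

theorem MeasureTheory.Lp.coeFn_finset_sum {ι : Type*} {p : ENNReal} (s : Finset ι)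
    (g : ι → Lp ℝ p μ) : ⇑(∑ i ∈ s, g i) =ᵐ[μ] fun x => ∑ i ∈ s, g i x := by
  classical
  induction s using Finset.induction_on with
  | empty => exact Lp.coeFn_zero ℝ p μ
  | insert i s hi ih =>
    simp only [Finset.sum_insert hi]
    exact (Lp.coeFn_add _ _).trans (EventuallyEq.rfl.add ih)

theorem coeFn_birkhoffAverage_compMeasurePreserving {p : ENNReal} {g : X → ℝ}
    (hS : MeasurePreserving S μ μ) (hg : MemLp g p μ) (n : ℕ) :
    (birkhoffAverage ℝ (Lp.compMeasurePreserving (E := ℝ) (p := p) S hS) id n (hg.toLp g) :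
      Lp ℝ p μ) =ᵐ[μ] birkhoffAverage ℝ S g n := by
  simp only [birkhoffAverage, birkhoffSum, id]
  refine (Lp.coeFn_smul _ _).trans (EventuallyEq.const_smul ?_ _)
  refine (Lp.coeFn_finset_sum _ _).trans ?_
  have h : ∀ᵐ x ∂μ, ∀ i, ((Lp.compMeasurePreserving (E := ℝ) (p := p) S hS)^[i]
      (hg.toLp g) : X → ℝ) x = g (S^[i] x) := by
    refine ae_all_iff.2 fun i => ?_
    rw [Lp.compMeasurePreserving_iterate, Lp.toLp_compMeasurePreserving]
    exact MemLp.coeFn_toLp _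
  filter_upwards [h] with x hx
  exact Finset.sum_congr rfl fun i _ => hx i

theorem Ergodic.exists_tendsto_eLpNorm_birkhoffAverage_sub_const [IsProbabilityMeasure μ]
    (hS : Ergodic S μ) {g : X → ℝ} (hg : MemLp g 2 μ) :
    ∃ c : ℝ, Tendsto (fun n => eLpNorm (birkhoffAverage ℝ S g n - fun _ => c) 2 μ)
      atTop (𝓝 0) := by
  let U : Lp ℝ 2 μ →L[ℝ] Lp ℝ 2 μ :=
    (Lp.compMeasurePreservingₗᵢ ℝ S hS.toMeasurePreserving).toContinuousLinearMap
  have hU : ‖U‖ ≤ 1 := LinearIsometry.norm_toContinuousLinearMap_le _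
  have hlim := U.tendsto_birkhoffAverage_orthogonalProjection hU (hg.toLp g)
  set P := (U.eqLocus (1 : Lp ℝ 2 μ →L[ℝ] Lp ℝ 2 μ)).orthogonalProjectionOnto (hg.toLp g)
  have hP : Lp.compMeasurePreserving S hS.toMeasurePreserving (P : Lp ℝ 2 μ) = P := P.2
  obtain ⟨c, hc⟩ := hS.ae_eq_const_of_ae_eq_comp_ae (Lp.aestronglyMeasurable (P : Lp ℝ 2 μ)) <| by
    have := Lp.coeFn_compMeasurePreserving (P : Lp ℝ 2 μ) hS.toMeasurePreserving
    rw [hP] at this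
    exact this.symm
  refine ⟨c, ?_⟩
  refine ((Lp.tendsto_Lp_iff_tendsto_eLpNorm' _ _).1 hlim).congr fun n => eLpNorm_congr_ae ?_
  exact (coeFn_birkhoffAverage_compMeasurePreserving hS.toMeasurePreserving hg n).sub hc

theorem MeasureTheory.MeasurePreserving.memLp_birkhoffAverage (hS : MeasurePreserving S μ μ)
    {p : ENNReal} {g : X → ℝ} (hg : MemLp g p μ) (n : ℕ) :
    MemLp (birkhoffAverage ℝ S g n) p μ := by
  have h : MemLp (fun x => ∑ i ∈ Finset.range n, g (S^[i] x)) p μ :=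
    memLp_finsetSum _ fun i _ => hg.comp_measurePreserving (hS.iterate i)
  exact h.const_smul ((n : ℝ)⁻¹)

theorem MeasureTheory.MeasurePreserving.eLpNorm_birkhoffAverage_le
    (hS : MeasurePreserving S μ μ) {g : X → ℝ} (hg : MemLp g 1 μ) (n : ℕ) :
    eLpNorm (birkhoffAverage ℝ S g n) 1 μ ≤ eLpNorm g 1 μ := by
  rcases n.eq_zero_or_pos with rfl | hn
  · simp
  have hsum : eLpNorm (birkhoffSum S g n) 1 μ ≤ n * eLpNorm g 1 μ := by
    have : birkhoffSum S g n = ∑ i ∈ Finset.range n, g ∘ S^[i] := by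
      ext x; simp [birkhoffSum]
    rw [this]
    refine (eLpNorm_sum_le (fun i _ => (hg.comp_measurePreserving (hS.iterate i)).1)
      le_rfl).trans ?_
    simp [eLpNorm_comp_measurePreserving hg.1 (hS.iterate _)]
  have : birkhoffAverage ℝ S g n = (n : ℝ)⁻¹ • birkhoffSum S g n := rfl
  rw [this, eLpNorm_const_smul]
  calc _ ≤ ‖(n : ℝ)⁻¹‖ₑ * (n * eLpNorm g 1 μ) := by gcongr
    _ = eLpNorm g 1 μ := by
      have hn' : (n : ℝ) ≠ 0 := by positivity
      have : ‖(n : ℝ)⁻¹‖ₑ * n = 1 := by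
        rw [enorm_inv hn', ← ENNReal.inv_mul_cancel (a := (n : ENNReal)) (by simp; omega) (by simp)]
        simp
      rw [← mul_assoc, this, one_mul]

theorem MeasureTheory.MeasurePreserving.integral_birkhoffAverage
    (hS : MeasurePreserving S μ μ) {g : X → ℝ} (hg : Integrable g μ) {n : ℕ} (hn : n ≠ 0) :
    ∫ x, birkhoffAverage ℝ S g n x ∂μ = ∫ x, g x ∂μ := by
  have h (i : ℕ) : ∫ x, g (S^[i] x) ∂μ = ∫ x, g x ∂μ := by
    have hi := hS.iterate i
    have := integral_map (μ := μ) hi.measurable.aemeasurable (f := g)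
      (by rw [hi.map_eq]; exact hg.1)
    rw [← this, hi.map_eq]
  simp only [birkhoffAverage, birkhoffSum]
  rw [integral_smul, integral_finsetSum]
  · simp [h, hn]
  · exact fun i _ => (hS.iterate i).integrable_comp_of_integrable hg

/-- The mean ergodic theorem in `L¹`, for a function of zero mean. -/
theorem Ergodic.tendsto_eLpNorm_one_birkhoffAverage_zero [IsProbabilityMeasure μ]
    (hS : Ergodic S μ) {f : X → ℝ}
    (hf : Integrable f μ) (hf0 : ∫ x, f x ∂μ = 0) :
    Tendsto (fun n => eLpNorm (birkhoffAverage ℝ S f n) 1 μ) atTop (𝓝 0) := by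
  have hS' := hS.toMeasurePreserving
  have hf1 : MemLp f 1 μ := memLp_one_iff_integrable.2 hf
  refine ENNReal.tendsto_nhds_zero.2 fun ε hε => ?_
  have hε3 : ε / 3 ≠ 0 := (ENNReal.div_pos hε.ne' (by simp)).ne'
  obtain ⟨g, hfg, hg1⟩ := hf1.exists_simpleFunc_eLpNorm_sub_lt (by simp) hε3
  have hg2 : MemLp g 2 μ := g.memLp_of_isFiniteMeasure 2 μ
  obtain ⟨c, hc⟩ := hS.exists_tendsto_eLpNorm_birkhoffAverage_sub_const hg2
  have hc1 : Tendsto (fun n => eLpNorm (birkhoffAverage ℝ S g n - fun _ => c) 1 μ)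
      atTop (𝓝 0) := by
    refine tendsto_of_tendsto_of_tendsto_of_le_of_le tendsto_const_nhds hc (fun _ => zero_le)
      fun n => ?_
    exact eLpNorm_le_eLpNorm_of_exponent_le (by norm_num)
      ((hS'.memLp_birkhoffAverage hg2 n).sub (memLp_const c)).1
  have hcg : c = ∫ x, g x ∂μ := by
    have h1 := tendsto_integral_of_L1' (fun _ => c) aestronglyMeasurable_const (F := fun n =>
      birkhoffAverage ℝ S g n) (l := atTop) (μ := μ) (.of_forall fun n =>
        memLp_one_iff_integrable.1 (hS'.memLp_birkhoffAverage hg1 n)) hc1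
    refine tendsto_nhds_unique (by simpa using h1) (tendsto_const_nhds.congr' ?_)
    filter_upwards [eventually_ne_atTop 0] with n hn
    exact (hS'.integral_birkhoffAverage (memLp_one_iff_integrable.1 hg1) hn).symm
  have hcε : eLpNorm (fun _ : X => c) 1 μ ≤ ε / 3 := by
    have hc' : c = - ∫ x, (f - g) x ∂μ := by
      have := integral_sub hf (memLp_one_iff_integrable.1 hg1)
      simp only [Pi.sub_apply]
      rw [this, hf0, ← hcg]; ring
    rw [eLpNorm_const _ one_ne_zero (IsProbabilityMeasure.ne_zero μ)]
    simp only [measure_univ, ENNReal.one_rpow, mul_one]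
    rw [hc', enorm_neg]
    refine (enorm_integral_le_lintegral_enorm _).trans ?_
    rw [← eLpNorm_one_eq_lintegral_enorm]
    exact hfg.le
  filter_upwards [ENNReal.tendsto_nhds_zero.1 hc1 (ε / 3) (pos_iff_ne_zero.2 hε3)] with n hn
  have hsplit : birkhoffAverage ℝ S f n = birkhoffAverage ℝ S (f - ⇑g) n +
      ((birkhoffAverage ℝ S g n - fun _ => c) + fun _ => c) := by
    ext x
    simp [birkhoffAverage, birkhoffSum, Finset.sum_sub_distrib, mul_sub]
  rw [hsplit]
  have m1 := hS'.memLp_birkhoffAverage (hf1.sub hg1) n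
  have m2 := (hS'.memLp_birkhoffAverage hg1 n).sub (memLp_const c)
  calc _ ≤ eLpNorm (birkhoffAverage ℝ S (f - ⇑g) n) 1 μ +
        (eLpNorm (birkhoffAverage ℝ S g n - fun _ => c) 1 μ + eLpNorm (fun _ : X => c) 1 μ) :=
        (eLpNorm_add_le m1.1 (m2.add (memLp_const c)).1 le_rfl).trans <|
          add_le_add le_rfl <| eLpNorm_add_le m2.1 aestronglyMeasurable_const le_rfl
    _ ≤ ε / 3 + (ε / 3 + ε / 3) := by
        gcongr
        exact (hS'.eLpNorm_birkhoffAverage_le (hf1.sub hg1) n).trans hfg.le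
    _ = ε := by rw [← add_assoc, ENNReal.add_thirds]

end MeanErgodic

section Recurrence

variable {X : Type*}

/-- The points whose Birkhoff sums of positive length never vanish. -/
def neverZeroSet (S : X → X) (f : X → ℤ) : Set X :=
  {x | ∀ n, 0 < n → birkhoffSum S f n x ≠ 0}

theorem injOn_birkhoffSum_neverZeroSet (S : X → X) (f : X → ℤ) (x : X) :
    Set.InjOn (fun i => birkhoffSum S f i x) {i | S^[i] x ∈ neverZeroSet S f} := by
  have key : ∀ i j, i < j → S^[i] x ∈ neverZeroSet S f →
      birkhoffSum S f i x ≠ birkhoffSum S f j x := by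
    intro i j hij hi h
    obtain ⟨k, rfl⟩ := Nat.exists_eq_add_of_le hij.le
    rw [birkhoffSum_add] at h
    exact hi k (by omega) (by linarith)
  intro i hi j hj h
  rcases lt_trichotomy i j with hij | hij | hij
  · exact (key i j hij hi h).elim
  · exact hij
  · exact (key j i hij hj h.symm).elim

theorem sum_indicator_neverZeroSet_le (S : X → X) (f : X → ℤ) (x : X) (n : ℕ) {M : ℕ}
    (hM : 0 < M) :
    ∑ i ∈ Finset.range n, (neverZeroSet S f).indicator (fun _ => (1 : ℝ)) (S^[i] x) ≤
      2 * M + 1 + ∑ i ∈ Finset.range n, |((birkhoffSum S f i x : ℤ) : ℝ)| / M := by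
  classical
  have hM' : (0 : ℝ) < M := by exact_mod_cast hM
  let I := (Finset.range n).filter fun i =>
    S^[i] x ∈ neverZeroSet S f ∧ |birkhoffSum S f i x| ≤ M
  have hI : (I.card : ℝ) ≤ 2 * M + 1 := by
    have : I.card ≤ (Finset.Icc (-(M : ℤ)) M).card := by
      refine Finset.card_le_card_of_injOn (fun i => birkhoffSum S f i x) ?_ ?_
      · intro i hi
        have := (Finset.mem_filter.1 hi).2.2
        simpa using abs_le.1 this
      · exact (injOn_birkhoffSum_neverZeroSet S f x).mono fun i hi =>
          (Finset.mem_filter.1 hi).2.1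
    rw [Int.card_Icc] at this
    have h2 : I.card ≤ 2 * M + 1 := by omega
    exact_mod_cast h2
  calc _ ≤ ∑ i ∈ Finset.range n, ((if S^[i] x ∈ neverZeroSet S f ∧ |birkhoffSum S f i x| ≤ M
        then (1 : ℝ) else 0) + |((birkhoffSum S f i x : ℤ) : ℝ)| / M) := by
        refine Finset.sum_le_sum fun i _ => ?_
        have h0 : 0 ≤ |((birkhoffSum S f i x : ℤ) : ℝ)| / M := by positivity
        by_cases hA : S^[i] x ∈ neverZeroSet S f
        · by_cases hle : |birkhoffSum S f i x| ≤ M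
          · simp [hA, hle, h0]
          · have : (M : ℝ) ≤ |((birkhoffSum S f i x : ℤ) : ℝ)| := by exact_mod_cast (not_le.1 hle).le
            simpa [hA, hle] using (one_le_div hM').2 this
        · simpa [hA] using h0
    _ ≤ _ := by
        rw [Finset.sum_add_distrib, Finset.sum_boole]
        gcongr

theorem infinite_setOf_birkhoffSum_eq_zero {S : X → X} {f : X → ℤ} {x : X}
    (hx : ∀ i, S^[i] x ∉ neverZeroSet S f) : {n | birkhoffSum S f n x = 0}.Infinite := by
  have h : ∀ m, ∃ n ≥ m, birkhoffSum S f n x = 0 := by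
    intro m
    induction m with
    | zero => exact ⟨0, le_rfl, by simp⟩
    | succ m ih =>
      obtain ⟨n, hn, hn0⟩ := ih
      have := hx n
      simp only [neverZeroSet, Set.mem_ofPred_eq, not_forall, not_not] at this
      obtain ⟨k, hk, hk0⟩ := this
      exact ⟨n + k, by omega, by rw [birkhoffSum_add, hn0, hk0, add_zero]⟩
  refine Set.infinite_of_forall_exists_gt fun m => ?_
  obtain ⟨n, hn, h0⟩ := h (m + 1)
  exact ⟨n, h0, by omega⟩

variable [MeasurableSpace X] {μ : Measure X} {S : X → X} {f : X → ℤ}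

theorem measurable_birkhoffSum_int (hS : Measurable S) (hf : Measurable f) (n : ℕ) :
    Measurable (birkhoffSum S f n) := by
  unfold birkhoffSum
  exact Finset.measurable_fun_sum _ fun i _ => hf.comp (hS.iterate i)

theorem measurableSet_neverZeroSet (hS : Measurable S) (hf : Measurable f) :
    MeasurableSet (neverZeroSet S f) := by
  have : neverZeroSet S f = ⋂ n, ⋂ (_ : 0 < n), (birkhoffSum S f n ⁻¹' {0})ᶜ := by
    ext x; simp [neverZeroSet]
  rw [this]
  exact .iInter fun n => .iInter fun _ =>
    (measurable_birkhoffSum_int hS hf n (measurableSet_singleton 0)).compl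

theorem integrable_birkhoffSum_int (hS : MeasurePreserving S μ μ)
    (hf : Integrable (fun x => (f x : ℝ)) μ) (n : ℕ) :
    Integrable (fun x => ((birkhoffSum S f n x : ℤ) : ℝ)) μ := by
  simp only [birkhoffSum, Int.cast_sum]
  exact integrable_finsetSum _ fun i _ => (hS.iterate i).integrable_comp_of_integrable hf

theorem mul_measureReal_neverZeroSet_le [IsProbabilityMeasure μ]
    (hS : MeasurePreserving S μ μ) (hfm : Measurable f)
    (hf : Integrable (fun x => (f x : ℝ)) μ) (n : ℕ) {M : ℕ} (hM : 0 < M) :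
    n * μ.real (neverZeroSet S f) ≤
      2 * M + 1 + (∑ i ∈ Finset.range n, ∫ x, |((birkhoffSum S f i x : ℤ) : ℝ)| ∂μ) / M := by
  have hA := measurableSet_neverZeroSet hS.measurable hfm
  have hind : Integrable ((neverZeroSet S f).indicator fun _ => (1 : ℝ)) μ :=
    (integrable_const 1).indicator hA
  have hL (i : ℕ) : Integrable
      (fun x => (neverZeroSet S f).indicator (fun _ => (1 : ℝ)) (S^[i] x)) μ :=
    (hS.iterate i).integrable_comp_of_integrable hind
  have hLi (i : ℕ) : ∫ x, (neverZeroSet S f).indicator (fun _ => (1 : ℝ)) (S^[i] x) ∂μ =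
      μ.real (neverZeroSet S f) := by
    have hi := hS.iterate i
    have := integral_map (μ := μ) hi.measurable.aemeasurable
      (f := (neverZeroSet S f).indicator fun _ => (1 : ℝ)) (by rw [hi.map_eq]; exact hind.1)
    rw [← this, hi.map_eq, integral_indicator_const _ hA, smul_eq_mul, mul_one]
  have hR (i : ℕ) : Integrable (fun x => |((birkhoffSum S f i x : ℤ) : ℝ)| / M) μ :=
    (integrable_birkhoffSum_int hS hf i).abs.div_const _
  have hRs := integrable_finsetSum (Finset.range n) fun i _ => hR i
  have := integral_mono (integrable_finsetSum (Finset.range n) fun i _ => hL i)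
    ((integrable_const (2 * M + 1 : ℝ)).add hRs)
    (fun x => sum_indicator_neverZeroSet_le S f x n hM)
  simp only [Pi.add_apply] at this
  rw [integral_finsetSum _ fun i _ => hL i, integral_add (integrable_const _) hRs,
    integral_finsetSum _ fun i _ => hR i] at this
  simpa [hLi, integral_div, Finset.sum_div] using this

theorem Ergodic.measure_neverZeroSet_eq_zero [IsProbabilityMeasure μ]
    (hS : Ergodic S μ) (hfm : Measurable f)
    (hf : Integrable (fun x => (f x : ℝ)) μ) (hf0 : ∫ x, (f x : ℝ) ∂μ = 0) :
    μ (neverZeroSet S f) = 0 := by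
  have hS' := hS.toMeasurePreserving
  let a (i : ℕ) : ℝ := (eLpNorm (birkhoffAverage ℝ S (fun x => (f x : ℝ)) i) 1 μ).toReal
  have ha : Tendsto a atTop (𝓝 0) := by
    simpa [a, Function.comp_def] using (ENNReal.tendsto_toReal ENNReal.zero_ne_top).comp
      (hS.tendsto_eLpNorm_one_birkhoffAverage_zero hf hf0)
  have hsum (i : ℕ) : ∫ x, |((birkhoffSum S f i x : ℤ) : ℝ)| ∂μ = i * a i := by
    rcases i.eq_zero_or_pos with rfl | hi
    · simp
    have hi' : (i : ℝ) ≠ 0 := by positivity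
    have hm := hS'.memLp_birkhoffAverage (memLp_one_iff_integrable.2 hf) i
    simp only [a]
    rw [eLpNorm_one_eq_lintegral_enorm, ← integral_norm_eq_lintegral_enorm hm.1,
      ← integral_const_mul]
    congr with x
    simp [birkhoffAverage, birkhoffSum, hi']
  let e (n : ℕ) : ℝ := (n : ℝ)⁻¹ * ∑ i ∈ Finset.range n, a i
  have he : Tendsto e atTop (𝓝 0) := ha.cesaro
  have hle (n : ℕ) (hn : 0 < n) (ε : ℝ) (hε : 0 < ε) :
      μ.real (neverZeroSet S f) ≤ 2 * ε + 3 * (n : ℝ)⁻¹ + e n / ε := by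
    have hn' : (0 : ℝ) < n := by exact_mod_cast hn
    have hεn : 0 < ε * n := by positivity
    have hM : 0 < ⌈ε * n⌉₊ := Nat.ceil_pos.2 hεn
    have h1 := mul_measureReal_neverZeroSet_le hS' hfm hf n hM
    have hMle : (⌈ε * n⌉₊ : ℝ) ≤ ε * n + 1 := (Nat.ceil_lt_add_one hεn.le).le
    have hMge : ε * n ≤ ⌈ε * n⌉₊ := Nat.le_ceil _
    have hs : ∑ i ∈ Finset.range n, ∫ x, |((birkhoffSum S f i x : ℤ) : ℝ)| ∂μ ≤ n * (n * e n) := by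
      simp only [hsum, e]
      rw [mul_inv_cancel_left₀ hn'.ne', Finset.mul_sum]
      refine Finset.sum_le_sum fun i hi => ?_
      have : (i : ℝ) ≤ n := by exact_mod_cast (Finset.mem_range.1 hi).le
      have : 0 ≤ a i := ENNReal.toReal_nonneg
      gcongr
    have h2 : (∑ i ∈ Finset.range n, ∫ x, |((birkhoffSum S f i x : ℤ) : ℝ)| ∂μ) / ⌈ε * n⌉₊ ≤
        n * (n * e n) / (ε * n) := by gcongr
    have h3 : n * μ.real (neverZeroSet S f) ≤ n * (2 * ε + 3 * (n : ℝ)⁻¹ + e n / ε) := by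
      have : n * (2 * ε + 3 * (n : ℝ)⁻¹ + e n / ε) =
          2 * (ε * n + 1) + 1 + n * (n * e n) / (ε * n) := by field_simp; ring
      rw [this]
      linarith
    exact le_of_mul_le_mul_left h3 hn'
  have hε (ε : ℝ) (hε : 0 < ε) : μ.real (neverZeroSet S f) ≤ 2 * ε := by
    have hlim : Tendsto (fun n : ℕ => 2 * ε + 3 * (n : ℝ)⁻¹ + e n / ε) atTop (𝓝 (2 * ε)) := by
      simpa using ((tendsto_inv_atTop_nhds_zero_nat (𝕜 := ℝ)).const_mul 3 |>.const_add
        (2 * ε)).add (he.div_const ε)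
    refine ge_of_tendsto hlim ?_
    filter_upwards [eventually_gt_atTop 0] with n hn using hle n hn ε hε
  refine (measureReal_eq_zero_iff).1 (le_antisymm ?_ measureReal_nonneg)
  refine le_of_forall_pos_le_add fun ε h => ?_
  linarith [hε (ε / 2) (by positivity)]

end Recurrence

/-- Krygin–Atkinson (integer-valued form): for an ergodic automorphism `S` of a
probability space and an integrable `f : X → ℤ` with zero mean, the Birkhoff sums
vanish infinitely often for a.e. `x`. -/
theorem krygin_atkinson_int
    {X : Type*} [MeasurableSpace X]
    (μ : Measure X) [IsProbabilityMeasure μ]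
    (S : X ≃ᵐ X) (hS : MeasurePreserving S μ μ)
    (hSerg : ∀ E : Set X, MeasurableSet E → (⇑S) ⁻¹' E =ᵐ[μ] E →
      μ E = 0 ∨ μ E = 1)
    (f : X → ℤ) (hf : Integrable (fun x => (f x : ℝ)) μ)
    (hf0 : ∫ x, (f x : ℝ) ∂μ = 0) :
    ∀ᵐ x ∂μ, {n : ℕ | ∑ i ∈ Finset.range n, f ((⇑S)^[i] x) = 0}.Infinite := by
  have hE : Ergodic S μ :=
    { hS with
      aeconst_set := fun E hEm hE => by
        rcases hSerg E hEm (.of_eq hE) with h | h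
        · exact eventuallyConst_set'.2 (.inl (ae_eq_empty.2 h))
        · exact eventuallyConst_set'.2 (.inr
            (ae_eq_univ.2 ((prob_compl_eq_zero_iff hEm).2 h))) }
  have hfm : AEMeasurable f μ := by
    simpa [Function.comp_def] using Int.measurable_floor.comp_aemeasurable hf.aemeasurable
  have hfg := hfm.ae_eq_mk
  have hcast : (fun x => (f x : ℝ)) =ᵐ[μ] fun x => ((hfm.mk f x : ℤ) : ℝ) := by
    filter_upwards [hfg] with x hx using congrArg Int.cast hx
  have hnull := hE.measure_neverZeroSet_eq_zero hfm.measurable_mk (hf.congr hcast)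
    (by rw [← integral_congr_ae hcast, hf0])
  have horbit : ∀ᵐ x ∂μ, ∀ i, S^[i] x ∉ neverZeroSet S (hfm.mk f) :=
    ae_all_iff.2 fun i =>
      (hS.iterate i).quasiMeasurePreserving.ae (measure_eq_zero_iff_ae_notMem.1 hnull)
  have hsum : ∀ᵐ x ∂μ, ∀ n, birkhoffSum S f n x = birkhoffSum S (hfm.mk f) n x :=
    ae_all_iff.2 fun n => hS.quasiMeasurePreserving.birkhoffSum_ae_eq_of_ae_eq hfg n
  filter_upwards [horbit, hsum] with x hx hsx
  have hinf := infinite_setOf_birkhoffSum_eq_zero hx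
  simp only [← hsx] at hinf
  exact hinf
end

section
/- Let X be a metric space equipped with a Borel probability measure μ that assigns positive measure to every nonempty open set, let S be an ergodic measure-preserving invertible transformation of (X,μ), and let f : X → ℤ be integrable with ∫_X f dμ = 0. Then for μ-almost every x ∈ X there exists a sequence of natural numbers n_k → ∞ such that S^{n_k} x → x and ∑_{i=0}^{n_k - 1} f(Sⁱ x) = 0 for every k. -/
open MeasureTheory Filter Topology

theorem MeasureTheory.MeasurePreserving.integrable_birkhoffSum {α : Type*} [MeasurableSpace α]
    {μ : Measure α} {S : α → α} (hS : MeasurePreserving S μ μ) {f : α → ℝ} (hf : Integrable f μ)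
    (n : ℕ) : Integrable (birkhoffSum S f n) μ :=
  integrable_finsetSum _ fun i _ => (hS.iterate i).integrable_comp_of_integrable hf

theorem MeasureTheory.MeasurePreserving.integral_comp_of_aestronglyMeasurable {α : Type*}
    [MeasurableSpace α] {μ : Measure α} {S : α → α} (hS : MeasurePreserving S μ μ) {f : α → ℝ}
    (hf : AEStronglyMeasurable f μ) : ∫ x, f (S x) ∂μ = ∫ x, f x ∂μ := by
  have h := integral_map hS.measurable.aemeasurable (f := f) (by rwa [hS.map_eq])
  rw [← h, hS.map_eq]

theorem MeasureTheory.MeasurePreserving.integral_birkhoffSum {α : Type*} [MeasurableSpace α]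
    {μ : Measure α} {S : α → α} (hS : MeasurePreserving S μ μ) {f : α → ℝ} (hf : Integrable f μ)
    (n : ℕ) : ∫ x, birkhoffSum S f n x ∂μ = n * ∫ x, f x ∂μ := by
  have h := integral_finsetSum (μ := μ) (Finset.range n) (f := fun i x => f (S^[i] x))
    fun i _ => (hS.iterate i).integrable_comp_of_integrable hf
  simp only [birkhoffSum]
  rw [h]
  simp [(hS.iterate _).integral_comp_of_aestronglyMeasurable hf.aestronglyMeasurable]

/-- The mean ergodic theorem in `L²`. -/
theorem Ergodic.exists_tendsto_eLpNorm_two_birkhoffAverage_sub {α : Type*} [MeasurableSpace α]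
    {μ : Measure α} {S : α → α} (hS : Ergodic S μ) {g : α → ℝ} (hg : MemLp g 2 μ) :
    ∃ c : ℝ, Tendsto (fun n => eLpNorm (fun x => birkhoffAverage ℝ S g n x - c) 2 μ)
      atTop (𝓝 0) := by
  have hmp := hS.toMeasurePreserving
  let U : Lp ℝ 2 μ →L[ℝ] Lp ℝ 2 μ :=
    (Lp.compMeasurePreservingₗᵢ ℝ S hmp).toContinuousLinearMap
  have hlim := U.tendsto_birkhoffAverage_orthogonalProjection
    (LinearIsometry.norm_toContinuousLinearMap_le _) (hg.toLp g)
  set p := (U.eqLocus (1 : Lp ℝ 2 μ →L[ℝ] Lp ℝ 2 μ)).orthogonalProjectionOnto (hg.toLp g)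
  have hp : Lp.compMeasurePreserving S hmp (p : Lp ℝ 2 μ) = p := p.2
  have hinv : (p : Lp ℝ 2 μ) ∘ S =ᵐ[μ] (p : Lp ℝ 2 μ) := by
    refine (Lp.coeFn_compMeasurePreserving _ hmp).symm.trans ?_
    rw [hp]
  obtain ⟨c, hc⟩ := hS.ae_eq_const_of_ae_eq_comp_ae (Lp.aestronglyMeasurable _) hinv
  have hpow (k : ℕ) : (U^[k] (hg.toLp g) : Lp ℝ 2 μ) =ᵐ[μ] g ∘ S^[k] := by
    have : U^[k] (hg.toLp g) = (hg.comp_measurePreserving (hmp.iterate k)).toLp _ := by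
      change (Lp.compMeasurePreserving S hmp)^[k] _ = _
      rw [Lp.compMeasurePreserving_iterate, Lp.toLp_compMeasurePreserving]
    rw [this]
    exact MemLp.coeFn_toLp _
  have havg (n : ℕ) : (birkhoffAverage ℝ U _root_.id n (hg.toLp g) : Lp ℝ 2 μ) =ᵐ[μ]
      birkhoffAverage ℝ S g n := by
    have hsum : ((∑ k ∈ Finset.range n, U^[k] (hg.toLp g) : Lp ℝ 2 μ) : α → ℝ) =ᵐ[μ]
        fun x => ∑ k ∈ Finset.range n, g (S^[k] x) := by
      filter_upwards [Lp.coeFn_finsetSum (Finset.range n) (fun k => U^[k] (hg.toLp g)),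
        ae_all_iff.2 hpow] with x hx hx'
      rw [hx, Finset.sum_apply]
      exact Finset.sum_congr rfl fun k _ => hx' k
    filter_upwards [Lp.coeFn_smul ((n : ℝ)⁻¹) (∑ k ∈ Finset.range n, U^[k] (hg.toLp g)), hsum]
      with x hx hx'
    simp only [birkhoffAverage, birkhoffSum, id]
    rw [hx, Pi.smul_apply, hx']
  refine ⟨c, ?_⟩
  rw [Lp.tendsto_Lp_iff_tendsto_eLpNorm'] at hlim
  refine hlim.congr fun n => eLpNorm_congr_ae ?_
  filter_upwards [havg n, hc] with x h1 h2
  simp [h1, h2]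

theorem Ergodic.tendsto_integral_abs_birkhoffAverage_of_integral_eq_zero {α : Type*}
    [MeasurableSpace α]
    {μ : Measure α} [IsProbabilityMeasure μ] {S : α → α} (hS : Ergodic S μ) {f : α → ℝ}
    (hf : Integrable f μ) (hf0 : ∫ x, f x ∂μ = 0) :
    Tendsto (fun n => ∫ x, |birkhoffAverage ℝ S f n x| ∂μ) atTop (𝓝 0) := by
  have hmp := hS.toMeasurePreserving
  have havgint {h : α → ℝ} (hh : Integrable h μ) (n : ℕ) :
      Integrable (birkhoffAverage ℝ S h n) μ :=
    (hmp.integrable_birkhoffSum hh n).smul ((n : ℝ)⁻¹)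
  have hsumle {h : α → ℝ} (hh : Integrable h μ) (n : ℕ) :
      ∫ x, |birkhoffAverage ℝ S h n x| ∂μ ≤ ∫ x, |h x| ∂μ := by
    have h1 : ∫ x, |birkhoffSum S h n x| ∂μ ≤ n * ∫ x, |h x| ∂μ := by
      calc ∫ x, |birkhoffSum S h n x| ∂μ ≤ ∫ x, birkhoffSum S (fun y => |h y|) n x ∂μ :=
            integral_mono (hmp.integrable_birkhoffSum hh n).abs
              (hmp.integrable_birkhoffSum hh.abs n) fun x => Finset.abs_sum_le_sum_abs _ _
        _ = n * ∫ x, |h x| ∂μ := hmp.integral_birkhoffSum hh.abs n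
    have h2 : ∀ x, |birkhoffAverage ℝ S h n x| = (n : ℝ)⁻¹ * |birkhoffSum S h n x| := fun x => by
      simp [birkhoffAverage, abs_mul]
    simp_rw [h2]
    rw [integral_const_mul]
    rcases n.eq_zero_or_pos with rfl | hn
    · simpa using integral_nonneg fun x => abs_nonneg (h x)
    · rw [inv_mul_le_iff₀ (by positivity)]
      exact h1
  have hmean {h : α → ℝ} (hh : Integrable h μ) {n : ℕ} (hn : n ≠ 0) :
      ∫ x, birkhoffAverage ℝ S h n x ∂μ = ∫ x, h x ∂μ := by
    simp only [birkhoffAverage, smul_eq_mul]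
    rw [integral_const_mul, hmp.integral_birkhoffSum hh]
    field_simp
  rw [Metric.tendsto_atTop]
  intro ε hε
  obtain ⟨g, hgf, -⟩ := (memLp_one_iff_integrable.2 hf).exists_simpleFunc_eLpNorm_sub_lt
    ENNReal.one_ne_top (ε := ENNReal.ofReal (ε / 4)) (by simpa using hε)
  have hg2 : MemLp g 2 μ := g.memLp_of_isFiniteMeasure 2 μ
  have hg : Integrable g μ := hg2.integrable (by norm_num)
  have hfg : ∫ x, |f x - g x| ∂μ < ε / 4 := by
    have := eLpNorm_one_eq_lintegral_enorm (f := f - ⇑g) (μ := μ)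
    have h2 := integral_norm_eq_lintegral_enorm (hf.sub hg).aestronglyMeasurable
    rw [← this] at h2
    simp only [Pi.sub_apply, Real.norm_eq_abs] at h2
    rw [h2]
    exact (ENNReal.lt_ofReal_iff_toReal_lt hgf.ne_top).1 hgf
  obtain ⟨c, hc⟩ := hS.exists_tendsto_eLpNorm_two_birkhoffAverage_sub hg2
  have hgint (n : ℕ) : Integrable (fun x => birkhoffAverage ℝ S g n x - c) μ :=
    (havgint hg n).sub (integrable_const c)
  have hc1 : ∀ᶠ n in atTop, ∫ x, |birkhoffAverage ℝ S g n x - c| ∂μ < ε / 4 := by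
    filter_upwards [hc.eventually_lt_const (show (0 : ENNReal) < ENNReal.ofReal (ε / 4) by
      simpa using hε)] with n hn
    have h1 : eLpNorm (fun x => birkhoffAverage ℝ S g n x - c) 1 μ < ENNReal.ofReal (ε / 4) :=
      (eLpNorm_le_eLpNorm_of_exponent_le (by norm_num)
        (hgint n).aestronglyMeasurable).trans_lt hn
    have h2 := integral_norm_eq_lintegral_enorm (hgint n).aestronglyMeasurable
    rw [← eLpNorm_one_eq_lintegral_enorm] at h2
    simp only [Real.norm_eq_abs] at h2
    rw [h2]
    exact (ENNReal.lt_ofReal_iff_toReal_lt h1.ne_top).1 h1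
  obtain ⟨N, hN⟩ := eventually_atTop.1 (hc1.and (eventually_ne_atTop 0))
  refine ⟨N, fun n hn => ?_⟩
  obtain ⟨hn1, hn0⟩ := hN n hn
  have hcs : |c| < ε / 2 := by
    have h1 : |∫ x, g x ∂μ - c| < ε / 4 := by
      have : ∫ x, g x ∂μ - c = ∫ x, (birkhoffAverage ℝ S g n x - c) ∂μ := by
        rw [integral_sub (havgint hg n) (integrable_const c), hmean hg hn0]
        simp
      rw [this]
      exact (abs_integral_le_integral_abs).trans_lt hn1
    have h2 : |∫ x, g x ∂μ| < ε / 4 := by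
      have : ∫ x, g x ∂μ = - ∫ x, (f x - g x) ∂μ := by
        rw [integral_sub hf hg, hf0]; ring
      rw [this, abs_neg]
      exact (abs_integral_le_integral_abs).trans_lt hfg
    rw [abs_lt] at *
    constructor <;> linarith
  have hfgi : Integrable (f - ⇑g) μ := hf.sub hg
  have hsumint : Integrable
      (fun x => |birkhoffAverage ℝ S (f - ⇑g) n x| + |birkhoffAverage ℝ S g n x - c|) μ :=
    (havgint hfgi n).abs.add (hgint n).abs
  have key : ∫ x, |birkhoffAverage ℝ S f n x| ∂μ ≤
      ∫ x, (|birkhoffAverage ℝ S (f - ⇑g) n x| + |birkhoffAverage ℝ S g n x - c| + |c|) ∂μ := by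
    refine integral_mono (havgint hf n).abs
      (hsumint.add (integrable_const _)) fun x => ?_
    have : birkhoffAverage ℝ S f n x =
        birkhoffAverage ℝ S (f - ⇑g) n x + (birkhoffAverage ℝ S g n x - c) + c := by
      rw [birkhoffAverage_sub]; simp
    simp only
    rw [this]
    exact abs_add_three _ _ _
  rw [integral_add hsumint (integrable_const _),
    integral_add (havgint hfgi n).abs (hgint n).abs] at key
  have h3 := hsumle hfgi n
  simp only [Pi.sub_apply] at h3
  rw [Real.dist_eq, sub_zero, abs_of_nonneg (integral_nonneg fun x => abs_nonneg _)]
  simp only [integral_const, probReal_univ, one_smul] at key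
  linarith

theorem secondCountableTopology_of_isOpenPosMeasure {X : Type*} [PseudoMetricSpace X]
    [MeasurableSpace X] [OpensMeasurableSpace X] (μ : Measure X) [SFinite μ]
    [μ.IsOpenPosMeasure] : SecondCountableTopology X := by
  refine Metric.secondCountable_of_almost_dense_set fun ε hε => ?_
  obtain ⟨s, hs⟩ := zorn_subset {s : Set X | s.Pairwise fun x y => ε < dist x y}
    fun c hc hchain => ⟨⋃₀ c, (Set.pairwise_sUnion hchain.directedOn).2 hc,
      fun _ => Set.subset_sUnion_of_mem⟩
  refine ⟨s, ?_, fun x => ?_⟩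
  · have h := Measure.countable_meas_pos_of_disjoint_iUnion (μ := μ)
      (As := fun x : s => Metric.ball (x : X) (ε / 2)) (fun _ => Metric.isOpen_ball.measurableSet)
      fun x y hxy => Metric.ball_disjoint_ball (by
        have := hs.prop x.2 y.2 (Subtype.coe_injective.ne hxy)
        linarith)
    have huniv : {x : s | 0 < μ (Metric.ball (x : X) (ε / 2))} = Set.univ :=
      Set.eq_univ_of_forall fun x => Metric.measure_ball_pos μ _ (by positivity)
    rw [huniv] at h
    exact Set.countable_coe_iff.1 (Set.countable_univ_iff.1 h)
  · by_contra! hx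
    have hins : insert x s ∈ {s : Set X | s.Pairwise fun x y => ε < dist x y} :=
      (hs.prop : s.Pairwise _).insert fun y hy _ => ⟨hx y hy, dist_comm x y ▸ hx y hy⟩
    have hxs : x ∈ s := hs.le_of_ge hins (Set.subset_insert x s) (Set.mem_insert x s)
    have := hx x hxs
    rw [dist_self] at this
    exact this.not_gt hε

/-- The skew product of `S` with the integer cocycle generated by `f`. -/
def intSkewProduct {α : Type*} (S : α → α) (f : α → ℤ) (z : α × ℤ) : α × ℤ :=
  (S z.1, f z.1 + z.2)

theorem intSkewProduct_iterate {α : Type*} (S : α → α) (f : α → ℤ) (n : ℕ) (z : α × ℤ) :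
    (intSkewProduct S f)^[n] z = (S^[n] z.1, birkhoffSum S f n z.1 + z.2) := by
  induction n with
  | zero => simp
  | succ n ih =>
    rw [Function.iterate_succ_apply', ih, birkhoffSum_succ, Function.iterate_succ_apply',
      intSkewProduct]
    simp only [Prod.mk.injEq, true_and]
    ring

theorem measurePreserving_intSkewProduct {α : Type*} [MeasurableSpace α] {μ : Measure α}
    [SFinite μ] {S : α → α} (hS : MeasurePreserving S μ μ) {f : α → ℤ} (hf : Measurable f) :
    MeasurePreserving (intSkewProduct S f) (μ.prod Measure.count) (μ.prod Measure.count) :=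
  hS.skew_product (g := fun x m => f x + m)
    ((hf.comp measurable_fst).add measurable_snd)
    (Eventually.of_forall fun x => (measurePreserving_add_left Measure.count (f x)).map_eq)

theorem card_filter_lt_le_of_injOn_int {N : ℕ} {p : ℕ → Prop} [DecidablePred p] {s : ℕ → ℤ}
    (hs : Set.InjOn s {n | p n}) (K : ℕ) :
    (((Finset.range N).filter p).card : ℝ) ≤
      2 * K + 1 + (∑ n ∈ Finset.range N, |(s n : ℝ)|) / (K + 1) := by
  have hsmall : (((Finset.range N).filter p).filter fun n => |s n| ≤ K).card ≤ 2 * K + 1 := by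
    have h := Finset.card_le_card_of_injOn
      (s := ((Finset.range N).filter p).filter fun n => |s n| ≤ K)
      (t := Finset.Icc (-(K : ℤ)) K) s
      (fun n hn => by
        simp only [Finset.coe_filter, Set.mem_ofPred_eq] at hn
        simpa [← abs_le] using hn.2)
      (hs.mono fun n hn => by
        simp only [Finset.coe_filter, Finset.mem_filter, Set.mem_ofPred_eq] at hn
        exact hn.1.2)
    rw [Int.card_Icc] at h
    omega
  have hlarge : ((((Finset.range N).filter p).filter fun n => ¬ |s n| ≤ K).card : ℝ) ≤
      (∑ n ∈ Finset.range N, |(s n : ℝ)|) / (K + 1) := by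
    rw [le_div_iff₀ (by positivity), ← nsmul_eq_mul]
    refine (Finset.card_nsmul_le_sum _ (fun n => |(s n : ℝ)|) _ fun n hn => ?_).trans
      (Finset.sum_le_sum_of_subset_of_nonneg
        ((Finset.filter_subset _ _).trans (Finset.filter_subset _ _))
        fun _ _ _ => abs_nonneg _)
    have h := (Finset.mem_filter.1 hn).2
    have h' : (K : ℤ) + 1 ≤ |s n| := by omega
    exact_mod_cast h'
  rw [← Finset.card_filter_add_card_filter_not (s := (Finset.range N).filter p)
    (fun n => |s n| ≤ K)]
  push_cast
  have : ((((Finset.range N).filter p).filter fun n => |s n| ≤ K).card : ℝ) ≤ 2 * K + 1 := by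
    exact_mod_cast hsmall
  linarith

theorem Ergodic.exists_sum_integral_abs_birkhoffSum_le {α : Type*} [MeasurableSpace α]
    {μ : Measure α} [IsProbabilityMeasure μ] {S : α → α} (hS : Ergodic S μ) {f : α → ℝ}
    (hf : Integrable f μ) (hf0 : ∫ x, f x ∂μ = 0) {δ : ℝ} (hδ : 0 < δ) :
    ∃ C : ℝ, 0 ≤ C ∧ ∀ N : ℕ,
      ∑ n ∈ Finset.range N, ∫ x, |birkhoffSum S f n x| ∂μ ≤ N * (δ * N + C) := by
  have hlim := hS.tendsto_integral_abs_birkhoffAverage_of_integral_eq_zero hf hf0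
  obtain ⟨M, hM⟩ := eventually_atTop.1
    ((hlim.eventually_lt_const hδ).and (eventually_ne_atTop 0))
  have hnonneg (n : ℕ) : 0 ≤ ∫ x, |birkhoffSum S f n x| ∂μ :=
    integral_nonneg fun x => abs_nonneg _
  have hsum : 0 ≤ ∑ n ∈ Finset.range M, ∫ x, |birkhoffSum S f n x| ∂μ :=
    Finset.sum_nonneg fun n _ => hnonneg n
  refine ⟨∑ n ∈ Finset.range M, ∫ x, |birkhoffSum S f n x| ∂μ, hsum, fun N => ?_⟩
  refine (Finset.sum_le_card_nsmul _ _ _ fun n hn => ?_).trans_eq (by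
    rw [Finset.card_range, nsmul_eq_mul])
  have hnN : (n : ℝ) ≤ N := by exact_mod_cast (Finset.mem_range.1 hn).le
  rcases lt_or_ge n M with hnM | hnM
  · have h := Finset.single_le_sum (f := fun n => ∫ x, |birkhoffSum S f n x| ∂μ)
      (fun n _ => hnonneg n) (Finset.mem_range.2 hnM)
    have : 0 ≤ δ * N := by positivity
    linarith
  · obtain ⟨h1, h2⟩ := hM n hnM
    have h3 (x : α) : |birkhoffAverage ℝ S f n x| = (n : ℝ)⁻¹ * |birkhoffSum S f n x| := by
      simp [birkhoffAverage, abs_mul]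
    simp_rw [h3] at h1
    rw [integral_const_mul, inv_mul_lt_iff₀ (by positivity)] at h1
    nlinarith

/-- **Atkinson's theorem**: an integer cocycle with zero mean over an ergodic map is recurrent. -/
theorem Ergodic.exists_mem_iterate_mem_birkhoffSum_eq_zero {α : Type*} [MeasurableSpace α]
    {μ : Measure α} [IsProbabilityMeasure μ] {S : α → α} (hS : Ergodic S μ) {f : α → ℤ}
    (hf : Integrable (fun x => (f x : ℝ)) μ) (hf0 : ∫ x, (f x : ℝ) ∂μ = 0) {A : Set α}
    (hA : MeasurableSet A) (hA0 : μ A ≠ 0) :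
    ∃ x ∈ A, ∃ m ≠ 0, S^[m] x ∈ A ∧ birkhoffSum S f m x = 0 := by
  classical
  by_contra! hcon
  have hmp := hS.toMeasurePreserving
  have hcast (n : ℕ) (x : α) :
      ((birkhoffSum S f n x : ℤ) : ℝ) = birkhoffSum S (fun y => (f y : ℝ)) n x := by
    simp [birkhoffSum]
  have hlt {x : α} {m n : ℕ} (hmn : m < n) (hm : S^[m] x ∈ A) (hn : S^[n] x ∈ A) :
      birkhoffSum S f m x ≠ birkhoffSum S f n x := by
    obtain ⟨k, rfl⟩ := Nat.exists_eq_add_of_lt hmn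
    have h := hcon _ hm (k + 1) k.succ_ne_zero (by
      rw [← Function.iterate_add_apply, add_comm]
      exact hn)
    rw [add_assoc, birkhoffSum_add]
    simpa using h
  have hinj (x : α) : Set.InjOn (fun n => birkhoffSum S f n x) {n | S^[n] x ∈ A} := by
    intro m hm n hn hmn
    by_contra hne
    rcases lt_or_gt_of_ne hne with h | h
    · exact hlt h hm hn hmn
    · exact hlt h hn hm hmn.symm
  have hvisit (N K : ℕ) : N * μ.real A ≤ 2 * K + 1 +
      (∑ n ∈ Finset.range N, ∫ x, |birkhoffSum S (fun y => (f y : ℝ)) n x| ∂μ) / (K + 1) := by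
    have hind : Integrable (A.indicator fun _ => (1 : ℝ)) μ :=
      (integrable_const _).indicator hA
    have habs (n : ℕ) : Integrable (fun x => |birkhoffSum S (fun y => (f y : ℝ)) n x|) μ :=
      (hmp.integrable_birkhoffSum hf n).abs
    have hsum : Integrable
        (fun x => ∑ n ∈ Finset.range N, |birkhoffSum S (fun y => (f y : ℝ)) n x|) μ :=
      integrable_finsetSum _ fun n _ => habs n
    calc N * μ.real A
        = ∫ x, birkhoffSum S (A.indicator fun _ => (1 : ℝ)) N x ∂μ := by
          rw [hmp.integral_birkhoffSum hind, integral_indicator_const _ hA, smul_eq_mul, mul_one]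
      _ ≤ ∫ x, (2 * K + 1 + (∑ n ∈ Finset.range N,
            |birkhoffSum S (fun y => (f y : ℝ)) n x|) / (K + 1)) ∂μ := by
          refine integral_mono (hmp.integrable_birkhoffSum hind N)
            ((integrable_const _).add (hsum.div_const _)) fun x => ?_
          have h := card_filter_lt_le_of_injOn_int (N := N) (hinj x) K
          simp only [hcast] at h
          refine le_trans (le_of_eq ?_) h
          simp [birkhoffSum, Set.indicator_apply]
      _ = _ := by
          rw [integral_add (integrable_const _) (hsum.div_const _), integral_div,
            integral_finsetSum _ fun n _ => habs n]
          simp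
  set a := μ.real A with ha
  have hapos : 0 < a := ENNReal.toReal_pos hA0 (measure_ne_top _ _)
  obtain ⟨C, hC0, hC⟩ := hS.exists_sum_integral_abs_birkhoffSum_le hf hf0
    (δ := a ^ 2 / 32) (by positivity)
  have hbound (N : ℕ) : N * a ≤ a * N / 2 + (1 + 8 * C / a) := by
    rcases N.eq_zero_or_pos with rfl | hN
    · have : 0 ≤ 8 * C / a := by positivity
      simp
      linarith
    have hNpos : (0 : ℝ) < N := by exact_mod_cast hN
    have h := hvisit N ⌊a / 8 * N⌋₊
    have hK1 : (⌊a / 8 * N⌋₊ : ℝ) ≤ a / 8 * N := Nat.floor_le (by positivity)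
    have hK2 : a / 8 * N < ⌊a / 8 * N⌋₊ + 1 := Nat.lt_floor_add_one _
    have hdiv : (∑ n ∈ Finset.range N, ∫ x, |birkhoffSum S (fun y => (f y : ℝ)) n x| ∂μ) /
        (⌊a / 8 * N⌋₊ + 1) ≤ a * N / 4 + 8 * C / a := by
      calc _ ≤ N * (a ^ 2 / 32 * N + C) / (a / 8 * N) := by
            refine div_le_div₀ (by positivity) (hC N) (by positivity) hK2.le
        _ = _ := by field_simp; ring
    linarith
  obtain ⟨N, hN⟩ := exists_nat_gt ((1 + 8 * C / a) / (a / 2))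
  rw [div_lt_iff₀ (by positivity)] at hN
  have := hbound N
  nlinarith

theorem conservative_intSkewProduct {α : Type*} [MeasurableSpace α]
    {μ : Measure α} [IsProbabilityMeasure μ] {S : α → α} (hS : Ergodic S μ) {f : α → ℤ}
    (hfm : Measurable f) (hf : Integrable (fun x => (f x : ℝ)) μ)
    (hf0 : ∫ x, (f x : ℝ) ∂μ = 0) :
    Conservative (intSkewProduct S f) (μ.prod Measure.count) where
  toQuasiMeasurePreserving :=
    (measurePreserving_intSkewProduct hS.toMeasurePreserving hfm).quasiMeasurePreserving
  exists_mem_iterate_mem' s hs hs0 := by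
    obtain ⟨c, hc⟩ : ∃ c : ℤ, μ ((fun x => (x, c)) ⁻¹' s) ≠ 0 := by
      by_contra! h
      exact hs0 (by simp [Measure.prod_apply_symm hs, h])
    obtain ⟨x, hx, m, hm, hxm, hsum⟩ :=
      hS.exists_mem_iterate_mem_birkhoffSum_eq_zero hf hf0 (measurable_prodMk_right hs) hc
    refine ⟨(x, c), hx, m, hm, ?_⟩
    rw [intSkewProduct_iterate, hsum, zero_add]
    exact hxm

theorem ae_exists_tendsto_iterate_of_measurable {X : Type*} [PseudoMetricSpace X]
    [SecondCountableTopology X] [MeasurableSpace X] [OpensMeasurableSpace X] {μ : Measure X}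
    [IsProbabilityMeasure μ] {S : X → X} (hS : Ergodic S μ) {f : X → ℤ} (hfm : Measurable f)
    (hf : Integrable (fun x => (f x : ℝ)) μ) (hf0 : ∫ x, (f x : ℝ) ∂μ = 0) :
    ∀ᵐ x ∂μ, ∃ n : ℕ → ℕ, Tendsto n atTop atTop ∧
      Tendsto (fun k => S^[n k] x) atTop (𝓝 x) ∧ ∀ k : ℕ, birkhoffSum S f (n k) x = 0 := by
  have hrec := (conservative_intSkewProduct hS hfm hf hf0).ae_frequently_mem_of_mem_nhds
  filter_upwards [Measure.ae_ae_of_ae_prod hrec] with x hx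
  have hx0 := Measure.ae_count_iff.1 hx 0
  have hfreq (k : ℕ) : ∃ n ≥ k, S^[n] x ∈ Metric.ball x (1 / (k + 1)) ∧
      birkhoffSum S f n x = 0 := by
    have hmem : Metric.ball x (1 / ((k : ℝ) + 1)) ×ˢ ({0} : Set ℤ) ∈ 𝓝 (x, (0 : ℤ)) :=
      prod_mem_nhds (Metric.ball_mem_nhds _ (by positivity)) (by simp)
    obtain ⟨n, hn, hmemn⟩ := frequently_atTop.1 (hx0 _ hmem) k
    rw [intSkewProduct_iterate] at hmemn
    exact ⟨n, hn, hmemn.1, by simpa using hmemn.2⟩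
  choose n hnk hball hsum using hfreq
  refine ⟨n, tendsto_atTop_mono hnk tendsto_id, ?_, hsum⟩
  rw [tendsto_iff_dist_tendsto_zero]
  exact squeeze_zero (fun _ => dist_nonneg) (fun k => (hball k).le)
    tendsto_one_div_add_atTop_nhds_zero_nat

/-- Metric version of Krygin–Atkinson: for an ergodic automorphism `S` of a metric
space with a Borel probability measure positive on nonempty open sets and an
integrable `f : X → ℤ` with zero mean, a.e. `x` admits `n k → ∞` with
`S^[n k] x → x` and vanishing Birkhoff sums. -/
theorem krygin_atkinson_metric
    {X : Type*} [MetricSpace X] [MeasurableSpace X] [BorelSpace X]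
    (μ : Measure X) [IsProbabilityMeasure μ]
    (hμpos : ∀ U : Set X, IsOpen U → U.Nonempty → 0 < μ U)
    (S : X ≃ᵐ X) (hS : MeasurePreserving S μ μ)
    (hSerg : ∀ E : Set X, MeasurableSet E → (⇑S) ⁻¹' E =ᵐ[μ] E →
      μ E = 0 ∨ μ E = 1)
    (f : X → ℤ) (hf : Integrable (fun x => (f x : ℝ)) μ)
    (hf0 : ∫ x, (f x : ℝ) ∂μ = 0) :
    ∀ᵐ x ∂μ, ∃ n : ℕ → ℕ, Tendsto n atTop atTop ∧
      Tendsto (fun k => (⇑S)^[n k] x) atTop (𝓝 x) ∧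
      ∀ k : ℕ, ∑ i ∈ Finset.range (n k), f ((⇑S)^[i] x) = 0 := by
  have : μ.IsOpenPosMeasure := ⟨fun U hU hne => (hμpos U hU hne).ne'⟩
  have : SecondCountableTopology X := secondCountableTopology_of_isOpenPosMeasure μ
  have hE : Ergodic S μ :=
    { hS with
      aeconst_set := fun E hE hinv => by
        rcases hSerg E hE hinv.eventuallyEq with h | h
        · exact eventuallyConst_set'.2 (Or.inl (ae_eq_empty.2 h))
        · refine eventuallyConst_set'.2 (Or.inr (ae_eq_univ.2 ?_))
          exact (prob_compl_eq_zero_iff hE).2 h }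
  obtain ⟨g, hgm, hfg⟩ : AEMeasurable f μ :=
    (Int.measurable_floor.comp_aemeasurable hf.aemeasurable).congr
      (Eventually.of_forall fun x => Int.floor_intCast (f x))
  have hfg' : (fun x => (f x : ℝ)) =ᵐ[μ] fun x => (g x : ℝ) := hfg.fun_comp _
  have hsum := fun n =>
    hS.quasiMeasurePreserving.birkhoffSum_ae_eq_of_ae_eq hfg n
  filter_upwards [ae_exists_tendsto_iterate_of_measurable hE hgm (hf.congr hfg')
    (integral_congr_ae hfg' ▸ hf0), ae_all_iff.2 hsum] with x ⟨n, hn, hlim, hzero⟩ hx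
  exact ⟨n, hn, hlim, fun k => (hx (n k)).trans (hzero k)⟩
end

section
/- (Shneiberg) Let T be an ergodic measure-preserving invertible transformation of a probability space (X,μ) and let f ∈ L¹(μ). Then for μ-almost every x ∈ X there exist sequences of natural numbers n_k → ∞ and p_k → ∞ such that for all k: S(x,n_k) − n_k ∫_X f dμ ≤ 0 and S(x,p_k) − p_k ∫_X f dμ ≥ 0, and moreover S(x,n_k)/n_k → ∫_X f dμ and S(x,p_k)/p_k → ∫_X f dμ. -/
open MeasureTheory Filter Topology

section ErgodicBirkhoffSum

variable {X : Type*} {T : X → X} {g : X → ℝ}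

/-- The maximum of `0` and the first `n` Birkhoff sums of `g`, through its recursion. -/
noncomputable def maxBirkhoffSum (T : X → X) (g : X → ℝ) : ℕ → X → ℝ
  | 0, _ => 0
  | n + 1, x => max 0 (g x + maxBirkhoffSum T g n (T x))

theorem maxBirkhoffSum_nonneg (n : ℕ) (x : X) : 0 ≤ maxBirkhoffSum T g n x := by
  cases n with
  | zero => exact le_rfl
  | succ n => exact le_max_left _ _

theorem maxBirkhoffSum_le_succ (n : ℕ) (x : X) :
    maxBirkhoffSum T g n x ≤ maxBirkhoffSum T g (n + 1) x := by
  induction n generalizing x with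
  | zero => exact le_max_left _ _
  | succ n ih => exact max_le_max le_rfl (by gcongr; exact ih _)

theorem birkhoffSum_le_maxBirkhoffSum (n : ℕ) (x : X) :
    birkhoffSum T g n x ≤ maxBirkhoffSum T g n x := by
  induction n generalizing x with
  | zero => simp [maxBirkhoffSum]
  | succ n ih =>
    rw [birkhoffSum_succ']
    exact (by gcongr; exact ih _ : _ ≤ g x + maxBirkhoffSum T g n (T x)).trans (le_max_right _ _)

theorem monotone_maxBirkhoffSum (x : X) : Monotone fun n => maxBirkhoffSum T g n x :=
  monotone_nat_of_le_succ fun n => maxBirkhoffSum_le_succ n x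

theorem birkhoffSum_sub_const (f : X → ℝ) (c : ℝ) (n : ℕ) (x : X) :
    birkhoffSum T (fun y => f y - c) n x = birkhoffSum T f n x - n * c := by
  simp [birkhoffSum]

theorem birkhoffSum_add_indicator_nonpos {A : Set X} {f : X → ℝ} {δ : ℝ}
    (hA : ∀ x ∈ A, ∀ n, 1 ≤ n → birkhoffSum T f n x ≤ -δ) (n : ℕ) :
    ∀ x ∈ A, birkhoffSum T (f + A.indicator fun _ => δ) n x ≤ 0 := by
  classical
  induction n using Nat.strong_induction_on with
  | _ n ih =>
  intro x hx
  rcases Nat.eq_zero_or_pos n with rfl | hn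
  · simp
  by_cases h : ∃ r, 1 ≤ r ∧ r < n ∧ T^[r] x ∈ A
  · obtain ⟨r, hr1, hrn, hr⟩ := h
    obtain ⟨m, rfl⟩ := Nat.exists_eq_add_of_le hrn.le
    rw [birkhoffSum_add]
    exact add_nonpos (ih r hrn x hx) (ih m (by lia) _ hr)
  · push Not at h
    have hsum : birkhoffSum T (A.indicator fun _ => δ) n x = δ := by
      rw [birkhoffSum, Finset.sum_eq_single_of_mem 0 (Finset.mem_range.2 hn)]
      · simp [hx]
      · exact fun i hi hi0 => Set.indicator_of_notMem
          (h i (Nat.one_le_iff_ne_zero.2 hi0) (Finset.mem_range.1 hi)) _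
    rw [birkhoffSum_add', hsum]
    linarith [hA x hx n hn]

variable [MeasurableSpace X] {μ : Measure X}

theorem measurable_birkhoffSum (hT : Measurable T) (hg : Measurable g) (n : ℕ) :
    Measurable (birkhoffSum T g n) :=
  Finset.measurable_fun_sum _ fun i _ => hg.comp (hT.iterate i)

theorem MeasureTheory.MeasurePreserving.integrable_maxBirkhoffSum (hT : MeasurePreserving T μ μ)
    (hg : Integrable g μ) (n : ℕ) : Integrable (maxBirkhoffSum T g n) μ := by
  induction n with
  | zero => exact integrable_zero X ℝ μ
  | succ n ih => exact (integrable_zero X ℝ μ).sup (hg.add (hT.integrable_comp_of_integrable ih))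

theorem MeasureTheory.MeasurePreserving.integral_comp_of_integrable (hT : MeasurePreserving T μ μ)
    (hg : Integrable g μ) : ∫ x, g (T x) ∂μ = ∫ x, g x ∂μ := by
  have h := integral_map (μ := μ) (φ := T) (f := g) hT.aemeasurable
    (by rw [hT.map_eq]; exact hg.aestronglyMeasurable)
  rw [← h, hT.map_eq]

/-- If almost every sequence of Birkhoff sums is unbounded above, the integral is nonnegative. -/
theorem MeasureTheory.MeasurePreserving.integral_nonneg_of_birkhoffSum_unbounded
    (hT : MeasurePreserving T μ μ) (hg : Integrable g μ)
    (h : ∀ᵐ x ∂μ, ∀ k : ℕ, ∃ n, (k : ℝ) < birkhoffSum T g n x) : 0 ≤ ∫ x, g x ∂μ := by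
  have hM := hT.integrable_maxBirkhoffSum hg
  have hMT n : Integrable (fun x => maxBirkhoffSum T g n (T x)) μ :=
    hT.integrable_comp_of_integrable (hM n)
  have hlim : Tendsto (fun n => ∫ x, max (-maxBirkhoffSum T g n (T x)) (g x) ∂μ) atTop
      (𝓝 (∫ x, g x ∂μ)) := by
    refine tendsto_integral_of_dominated_convergence (fun x => |g x|)
      (fun n => ((hMT n).neg.sup hg).aestronglyMeasurable) hg.abs ?_ ?_
    · refine fun n => Eventually.of_forall fun x => ?_
      have h0 := maxBirkhoffSum_nonneg (T := T) (g := g) n (T x)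
      rw [Real.norm_eq_abs, abs_le]
      exact ⟨(neg_abs_le _).trans (le_max_right _ _),
        max_le (by linarith [abs_nonneg (g x)]) (le_abs_self _)⟩
    · filter_upwards [hT.quasiMeasurePreserving.ae h] with x hx
      obtain ⟨k, hk⟩ := exists_nat_ge (-g x)
      obtain ⟨n, hn⟩ := hx k
      refine tendsto_const_nhds.congr' ?_
      filter_upwards [eventually_ge_atTop n] with m hm
      have h1 := birkhoffSum_le_maxBirkhoffSum (T := T) (g := g) n (T x)
      have h2 : maxBirkhoffSum T g n (T x) ≤ maxBirkhoffSum T g m (T x) :=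
        monotone_maxBirkhoffSum (T x) hm
      exact (max_eq_right (by linarith)).symm
  refine ge_of_tendsto' hlim fun n => ?_
  calc (0 : ℝ) ≤ ∫ x, maxBirkhoffSum T g (n + 1) x ∂μ - ∫ x, maxBirkhoffSum T g n (T x) ∂μ := by
        rw [hT.integral_comp_of_integrable (hM n), sub_nonneg]
        exact integral_mono (hM n) (hM (n + 1)) (maxBirkhoffSum_le_succ n)
    _ = ∫ x, max (-maxBirkhoffSum T g n (T x)) (g x) ∂μ := by
        rw [← integral_sub (hM _) (hMT n)]
        refine integral_congr_ae (Eventually.of_forall fun x => ?_)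
        simp only [maxBirkhoffSum]
        rw [← max_sub_sub_right, zero_sub, add_sub_cancel_right]

theorem Ergodic.ae_bddAbove_birkhoffSum (hT : Ergodic T μ) (hgm : Measurable g)
    (hg : Integrable g μ) (hneg : ∫ x, g x ∂μ < 0) :
    ∀ᵐ x ∂μ, ∃ k : ℕ, ∀ n, birkhoffSum T g n x ≤ k := by
  have hmeas : MeasurableSet {x | ∀ k : ℕ, ∃ n, (k : ℝ) < birkhoffSum T g n x} := by
    simp only [Set.ofPred_forall, Set.ofPred_exists]
    exact .iInter fun k => .iUnion fun n =>
      measurableSet_lt measurable_const (measurable_birkhoffSum hT.measurable hgm n)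
  have hinv : T ⁻¹' {x | ∀ k : ℕ, ∃ n, (k : ℝ) < birkhoffSum T g n x} =
      {x | ∀ k : ℕ, ∃ n, (k : ℝ) < birkhoffSum T g n x} := by
    ext x
    refine ⟨fun h k => ?_, fun h k => ?_⟩
    · obtain ⟨j, hj⟩ := exists_nat_ge (k - g x)
      obtain ⟨n, hn⟩ := h j
      refine ⟨n + 1, ?_⟩
      rw [birkhoffSum_succ']
      linarith
    · obtain ⟨j, hj⟩ := exists_nat_ge (k + g x)
      obtain ⟨n, hn⟩ := h j
      cases n with
      | zero =>
        rw [birkhoffSum_zero] at hn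
        exact absurd hn (not_lt.2 j.cast_nonneg)
      | succ n =>
        rw [birkhoffSum_succ'] at hn
        exact ⟨n, by linarith⟩
  rcases hT.toPreErgodic.ae_mem_or_ae_notMem hmeas hinv with h | h
  · exact absurd (hT.toMeasurePreserving.integral_nonneg_of_birkhoffSum_unbounded hg h) hneg.not_ge
  · filter_upwards [h] with x hx
    simpa using hx

variable [IsProbabilityMeasure μ]

theorem Ergodic.ae_eventually_birkhoffSum_div_lt (hT : Ergodic T μ) (hgm : Measurable g)
    (hg : Integrable g μ) {c : ℝ} (hc : ∫ x, g x ∂μ < c) :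
    ∀ᵐ x ∂μ, ∀ᶠ n : ℕ in atTop, birkhoffSum T g n x / n < c := by
  obtain ⟨b, hb, hbc⟩ := exists_between hc
  have h := hT.ae_bddAbove_birkhoffSum (g := fun x => g x - b) (hgm.sub_const b)
    (hg.sub (integrable_const b)) (by
      rw [integral_sub hg (integrable_const b)]
      simpa using hb)
  filter_upwards [h] with x ⟨k, hk⟩
  have hlim := tendsto_const_div_atTop_nhds_zero_nat (k : ℝ)
  filter_upwards [hlim.eventually_lt_const (sub_pos.2 hbc), eventually_gt_atTop 0] with n hn hn0
  have hn0' : (0 : ℝ) < n := Nat.cast_pos.2 hn0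
  have := hk n
  rw [birkhoffSum_sub_const] at this
  rw [div_lt_iff₀ hn0'] at hn ⊢
  linarith

/-- Birkhoff's pointwise ergodic theorem for an ergodic map of a probability space. -/
theorem Ergodic.ae_tendsto_birkhoffSum_div (hT : Ergodic T μ) (hgm : Measurable g)
    (hg : Integrable g μ) :
    ∀ᵐ x ∂μ, Tendsto (fun n : ℕ => birkhoffSum T g n x / n) atTop (𝓝 (∫ y, g y ∂μ)) := by
  have hpos (m : ℕ) : (0 : ℝ) < 1 / (m + 1) := Nat.one_div_pos_of_nat
  have hup := ae_all_iff.2 fun m : ℕ =>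
    hT.ae_eventually_birkhoffSum_div_lt hgm hg (lt_add_of_pos_right _ (hpos m))
  have hlow := ae_all_iff.2 fun m : ℕ =>
    hT.ae_eventually_birkhoffSum_div_lt hgm.neg hg.neg (lt_add_of_pos_right _ (hpos m))
  filter_upwards [hup, hlow] with x hux hlx
  refine tendsto_order.2 ⟨fun a ha => ?_, fun a ha => ?_⟩
  · obtain ⟨m, hm⟩ := exists_nat_one_div_lt (sub_pos.2 ha)
    filter_upwards [hlx m] with n hn
    rw [birkhoffSum_neg, neg_div] at hn
    simp only [Pi.neg_apply, integral_neg] at hn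
    linarith
  · obtain ⟨m, hm⟩ := exists_nat_one_div_lt (sub_pos.2 ha)
    filter_upwards [hux m] with n hn
    linarith

theorem Ergodic.ae_not_birkhoffSum_le_neg (hT : Ergodic T μ) (hgm : Measurable g)
    (hg : Integrable g μ) (h0 : ∫ x, g x ∂μ = 0) {δ : ℝ} (hδ : 0 < δ) :
    ∀ᵐ x ∂μ, ¬ ∀ n, 1 ≤ n → birkhoffSum T g n x ≤ -δ := by
  set A := {x | ∀ n, 1 ≤ n → birkhoffSum T g n x ≤ -δ} with hAdef
  have hA : MeasurableSet A := by
    simp only [hAdef, Set.ofPred_forall]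
    exact .iInter fun n => .iInter fun _ =>
      measurableSet_le (measurable_birkhoffSum hT.measurable hgm n) measurable_const
  change ∀ᵐ x ∂μ, x ∉ A
  rw [← measure_eq_zero_iff_ae_notMem]
  by_contra hne
  have hI : Integrable (A.indicator fun _ => δ) μ := (integrable_const δ).indicator hA
  have hint : 0 < ∫ x, (g + A.indicator fun _ => δ) x ∂μ := by
    simp only [Pi.add_apply]
    rw [integral_add hg hI, h0, integral_indicator_const _ hA, zero_add, smul_eq_mul]
    exact mul_pos (ENNReal.toReal_pos hne (measure_ne_top _ _)) hδ
  have hlim := hT.ae_tendsto_birkhoffSum_div (hgm.add (measurable_const.indicator hA)) (hg.add hI)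
  refine hne (measure_eq_zero_iff_ae_notMem.2 ?_)
  filter_upwards [hlim] with x hx hxA
  refine hint.not_ge (le_of_tendsto' hx fun n => ?_)
  exact div_nonpos_of_nonpos_of_nonneg
    (birkhoffSum_add_indicator_nonpos (fun _ h => h) n x hxA) n.cast_nonneg

theorem Ergodic.ae_exists_birkhoffSum_nonneg (hT : Ergodic T μ) (hgm : Measurable g)
    (hg : Integrable g μ) (h0 : ∫ x, g x ∂μ = 0) :
    ∀ᵐ x ∂μ, ∃ n, 1 ≤ n ∧ 0 ≤ birkhoffSum T g n x := by
  set A := {x | ∀ n, 1 ≤ n → birkhoffSum T g n x < 0} with hAdef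
  have hA : MeasurableSet A := by
    simp only [hAdef, Set.ofPred_forall]
    exact .iInter fun n => .iInter fun _ =>
      measurableSet_lt (measurable_birkhoffSum hT.measurable hgm n) measurable_const
  have hrec := hT.toMeasurePreserving.conservative.ae_mem_imp_frequently_image_mem
    hA.nullMeasurableSet
  have hnull := ae_all_iff.2 fun m : ℕ =>
    hT.ae_not_birkhoffSum_le_neg hgm hg h0 (Nat.one_div_pos_of_nat (α := ℝ) (n := m))
  filter_upwards [hrec, hnull] with x hx hnx
  by_contra! hxA
  obtain ⟨r, hr1, hr⟩ := frequently_atTop.1 (hx hxA) 1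
  have hsmall : ∀ᶠ m : ℕ in atTop, ∀ n ∈ Finset.Icc 1 r,
      (1 : ℝ) / (m + 1) < -birkhoffSum T g n x :=
    (Finset.eventually_all _).2 fun n hn =>
      tendsto_one_div_add_atTop_nhds_zero_nat.eventually_lt_const
        (neg_pos.2 (hxA n (Finset.mem_Icc.1 hn).1))
  obtain ⟨m, hm⟩ := hsmall.exists
  refine hnx m fun n hn => ?_
  rcases le_or_gt n r with hnr | hnr
  · linarith [hm n (Finset.mem_Icc.2 ⟨hn, hnr⟩)]
  · obtain ⟨j, rfl⟩ := Nat.exists_eq_add_of_le hnr.le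
    rw [birkhoffSum_add]
    linarith [hm r (Finset.mem_Icc.2 ⟨hr1, le_rfl⟩), hr j (by lia)]

theorem Ergodic.ae_frequently_birkhoffSum_nonneg (hT : Ergodic T μ) (hgm : Measurable g)
    (hg : Integrable g μ) (h0 : ∫ x, g x ∂μ = 0) :
    ∀ᵐ x ∂μ, ∃ᶠ n in atTop, 0 ≤ birkhoffSum T g n x := by
  have h := ae_all_iff.2 fun k : ℕ => (hT.quasiMeasurePreserving.iterate k).ae
    (hT.ae_exists_birkhoffSum_nonneg hgm hg h0)
  filter_upwards [h] with x hx
  refine frequently_atTop.2 fun N => ?_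
  induction N with
  | zero => exact ⟨0, le_rfl, by simp⟩
  | succ N ih =>
    obtain ⟨k, hk, hk0⟩ := ih
    obtain ⟨n, hn, hn0⟩ := hx k
    refine ⟨k + n, by lia, ?_⟩
    rw [birkhoffSum_add]
    exact add_nonneg hk0 hn0

end ErgodicBirkhoffSum

/-- Shneiberg: for an ergodic automorphism `T` of a probability space and `f ∈ L¹(μ)`,
for a.e. `x` there are `n k, p k → ∞` with Birkhoff sums below (resp. above)
`n k ∫ f` (resp. `p k ∫ f`), whose time averages converge to `∫ f`. -/
theorem shneiberg_discrete
    {X : Type*} [MeasurableSpace X]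
    (μ : Measure X) [IsProbabilityMeasure μ]
    (T : X ≃ᵐ X) (hT : MeasurePreserving T μ μ)
    (hTerg : ∀ E : Set X, MeasurableSet E → (⇑T) ⁻¹' E =ᵐ[μ] E →
      μ E = 0 ∨ μ E = 1)
    (f : X → ℝ) (hf : Integrable f μ) :
    ∀ᵐ x ∂μ, ∃ n p : ℕ → ℕ,
      Tendsto n atTop atTop ∧ Tendsto p atTop atTop ∧
      (∀ k : ℕ,
        (∑ i ∈ Finset.range (n k), f ((⇑T)^[i] x)) - (n k : ℝ) * ∫ y, f y ∂μ ≤ 0) ∧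
      (∀ k : ℕ,
        0 ≤ (∑ i ∈ Finset.range (p k), f ((⇑T)^[i] x)) - (p k : ℝ) * ∫ y, f y ∂μ) ∧
      Tendsto (fun k => (∑ i ∈ Finset.range (n k), f ((⇑T)^[i] x)) / (n k : ℝ))
        atTop (𝓝 (∫ y, f y ∂μ)) ∧
      Tendsto (fun k => (∑ i ∈ Finset.range (p k), f ((⇑T)^[i] x)) / (p k : ℝ))
        atTop (𝓝 (∫ y, f y ∂μ)) := by
  have hE : Ergodic T μ := ⟨hT, ⟨fun s hs hinv => by
    rw [eventuallyConst_set']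
    rcases hTerg s hs hinv.eventuallyEq with h | h
    · exact .inl (ae_eq_empty.2 h)
    · exact .inr (ae_eq_univ.2 ((prob_compl_eq_zero_iff hs).2 h))⟩⟩
  set c := ∫ y, f y ∂μ
  set F := hf.aestronglyMeasurable.mk f
  have hfF : f =ᵐ[μ] F := hf.aestronglyMeasurable.ae_eq_mk
  have hFm : Measurable F := hf.aestronglyMeasurable.stronglyMeasurable_mk.measurable
  have hFi : Integrable F μ := hf.congr hfF
  have hFc : ∫ y, F y ∂μ = c := (integral_congr_ae hfF).symm
  have hGm : Measurable fun x => F x - c := hFm.sub_const c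
  have hGi : Integrable (fun x => F x - c) μ := hFi.sub (integrable_const c)
  have hG0 : ∫ x, (F x - c) ∂μ = 0 := by
    rw [integral_sub hFi (integrable_const c), hFc]
    simp
  have hsum := ae_all_iff.2 (hT.quasiMeasurePreserving.birkhoffSum_ae_eq_of_ae_eq hfF)
  filter_upwards [hsum, hE.ae_tendsto_birkhoffSum_div hFm hFi,
    hE.ae_frequently_birkhoffSum_nonneg hGm hGi hG0,
    hE.ae_frequently_birkhoffSum_nonneg hGm.neg hGi.neg (by
      simp only [Pi.neg_apply, integral_neg, hG0, neg_zero])] with x hx hlim hp hn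
  obtain ⟨p, hp, hp0⟩ := extraction_of_frequently_atTop hp
  obtain ⟨n, hn, hn0⟩ := extraction_of_frequently_atTop hn
  simp only [birkhoffSum_neg, birkhoffSum_sub_const, ← hx, hFc] at hlim hp0 hn0
  exact ⟨n, p, hn.tendsto_atTop, hp.tendsto_atTop, fun k => neg_nonneg.1 (hn0 k), hp0,
    hlim.comp hn.tendsto_atTop, hlim.comp hp.tendsto_atTop⟩
end

section
/- (Shneiberg, continuous time) Let (T_t)_{t∈ℝ} be an ergodic measurable measure-preserving flow on a probability space (X,μ) and let f : X → ℝ be integrable with ∫_X f dμ = 0. Then for μ-almost every x ∈ X there exists a sequence t_k → ∞ such that ∫_0^{t_k} f(T_s x) ds = 0 for all k. -/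
open MeasureTheory Filter

/-- An integrable coboundary of a measurable function has zero mean, even if the transfer function
is not integrable. -/
theorem MeasureTheory.MeasurePreserving.integral_sub_comp_eq_zero {X : Type*} [MeasurableSpace X]
    {μ : Measure X} [IsFiniteMeasure μ] {τ : X → X} (hτ : MeasurePreserving τ μ μ) {g : X → ℝ}
    (hg : Measurable g) (hint : Integrable (fun x => g x - g (τ x)) μ) :
    ∫ x, (g x - g (τ x)) ∂μ = 0 := by
  let c : ℕ → ℝ → ℝ := fun n a => max (-(n : ℝ)) (min a n)
  have hc (n : ℕ) : Measurable (c n) := by fun_prop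
  have hcint (n : ℕ) : Integrable (fun x => c n (g x)) μ := by
    refine Integrable.of_bound ((hc n).comp hg).aestronglyMeasurable n (ae_of_all _ fun x => ?_)
    have : (0 : ℝ) ≤ n := n.cast_nonneg
    exact abs_le.2 ⟨le_max_left _ _, max_le (by linarith) (min_le_right _ _)⟩
  have hzero (n : ℕ) : ∫ x, (c n (g x) - c n (g (τ x))) ∂μ = 0 := by
    have h2 : Integrable (fun x => c n (g (τ x))) μ := hτ.integrable_comp_of_integrable (hcint n)
    have h3 : ∫ x, c n (g (τ x)) ∂μ = ∫ x, c n (g x) ∂μ := by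
      have := integral_map (μ := μ) hτ.measurable.aemeasurable
        (f := fun x => c n (g x)) ((hc n).comp hg).aestronglyMeasurable
      rw [hτ.map_eq] at this
      exact this.symm
    rw [integral_sub (hcint n) h2, h3, sub_self]
  have hev (a : ℝ) : ∀ᶠ n : ℕ in atTop, c n a = a := by
    obtain ⟨N, hN⟩ := exists_nat_ge |a|
    filter_upwards [eventually_ge_atTop N] with n hn
    have hn' : |a| ≤ n := hN.trans (by exact_mod_cast hn)
    obtain ⟨h1, h2⟩ := abs_le.1 hn'
    simp [c, h1, h2]
  have hlim := tendsto_integral_of_dominated_convergence (μ := μ)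
    (F := fun (n : ℕ) x => c n (g x) - c n (g (τ x))) (f := fun x => g x - g (τ x))
    (fun x => ‖g x - g (τ x)‖)
    (fun n => (((hc n).comp hg).sub ((hc n).comp (hg.comp hτ.measurable))).aestronglyMeasurable)
    hint.norm
    (fun n => ae_of_all _ fun x => by
      have h1 := abs_max_sub_max_le_abs (min (g x) n) (min (g (τ x)) n) (-(n : ℝ))
      have h2 := abs_min_sub_min_le_max (g x) n (g (τ x)) n
      simp only [sub_self, abs_zero, abs_nonneg, max_eq_left] at h2
      simp only [c, Real.norm_eq_abs]
      rw [max_comm (-(n : ℝ)), max_comm (-(n : ℝ))]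
      exact h1.trans h2)
    (ae_of_all _ fun x => by
      refine tendsto_const_nhds.congr' ?_
      filter_upwards [hev (g x), hev (g (τ x))] with n h1 h2
      rw [h1, h2])
  simp only [hzero] at hlim
  exact tendsto_nhds_unique hlim tendsto_const_nhds

/-- The Birkhoff sums of a function of zero mean cannot tend to `∞` almost everywhere. -/
theorem MeasureTheory.MeasurePreserving.not_ae_tendsto_birkhoffSum {X : Type*} [MeasurableSpace X]
    {μ : Measure X} [IsFiniteMeasure μ] [NeZero μ] {τ : X → X} (hτ : MeasurePreserving τ μ μ)
    {φ : X → ℝ} (hφm : Measurable φ) (hφ : Integrable φ μ) (hφ0 : ∫ x, φ x ∂μ = 0) :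
    ¬ ∀ᵐ x ∂μ, Tendsto (fun n => birkhoffSum τ φ n x) atTop atTop := by
  intro htend
  have hSm (n : ℕ) : Measurable (birkhoffSum τ φ n) := by
    unfold birkhoffSum
    exact Finset.measurable_sum _ fun k _ => hφm.comp (hτ.measurable.iterate k)
  let g : X → ℝ := fun x => ⨆ n, -birkhoffSum τ φ n x
  have hgm : Measurable g := Measurable.iSup fun n => (hSm n).neg
  have hbdd {x : X} (hx : Tendsto (fun n => birkhoffSum τ φ n x) atTop atTop) :
      BddAbove (Set.range fun n => -birkhoffSum τ φ n x) :=
    bddAbove_range_of_tendsto_atTop_atBot (tendsto_neg_atTop_atBot.comp hx)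
  have hrec : ∀ᵐ x ∂μ, g x = max 0 (g (τ x) - φ x) := by
    filter_upwards [htend, hτ.quasiMeasurePreserving.ae htend] with x hx hx'
    apply le_antisymm
    · refine ciSup_le fun n => ?_
      cases n with
      | zero => simp
      | succ n =>
        have := le_ciSup (hbdd hx') n
        rw [birkhoffSum_succ']
        refine le_max_of_le_right ?_
        change _ ≤ (⨆ n, -birkhoffSum τ φ n (τ x)) - φ x
        linarith
    · refine max_le ?_ ?_
      · simpa using le_ciSup (hbdd hx) 0
      · rw [sub_le_iff_le_add]
        refine ciSup_le fun n => ?_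
        have := le_ciSup (hbdd hx) (n + 1)
        simp only [birkhoffSum_succ'] at this
        change _ ≤ (⨆ n, -birkhoffSum τ φ n x) + φ x
        linarith
  have hnonneg : ∀ᵐ x ∂μ, 0 ≤ g x := by
    filter_upwards [hrec] with x hx
    rw [hx]
    exact le_max_left _ _
  have hh : Integrable (fun x => g x - g (τ x) + φ x) μ := by
    refine hφ.norm.mono' ((hgm.sub (hgm.comp hτ.measurable)).add hφm).aestronglyMeasurable ?_
    filter_upwards [hrec, hτ.quasiMeasurePreserving.ae hnonneg] with x hx hx'
    rw [hx, Real.norm_eq_abs, Real.norm_eq_abs, abs_le]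
    have h1 := neg_abs_le (φ x)
    have h2 := le_abs_self (φ x)
    rcases max_cases 0 (g (τ x) - φ x) with h | h <;> constructor <;> linarith
  have hcob : Integrable (fun x => g x - g (τ x)) μ := by
    simpa [Pi.sub_def] using hh.sub hφ
  have hsum : ∫ x, (g x - g (τ x) + φ x) ∂μ = 0 := by
    rw [integral_add hcob hφ, hτ.integral_sub_comp_eq_zero hgm hcob, hφ0, add_zero]
  rw [integral_eq_zero_iff_of_nonneg_ae _ hh] at hsum
  swap
  · filter_upwards [hrec] with x hx
    have := le_max_right 0 (g (τ x) - φ x)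
    simp only [Pi.zero_apply]
    linarith
  have hall : ∀ᵐ x ∂μ, ∀ n : ℕ, g (τ^[n] x) = g x + birkhoffSum τ φ n x := by
    have h1 : ∀ᵐ x ∂μ, ∀ n : ℕ, g (τ^[n + 1] x) = g (τ^[n] x) + φ (τ^[n] x) := by
      refine ae_all_iff.2 fun n => ?_
      filter_upwards [(hτ.iterate n).quasiMeasurePreserving.ae hsum] with x hx
      simp only [Pi.zero_apply] at hx
      rw [Function.iterate_succ_apply']
      linarith
    filter_upwards [h1] with x hx n
    induction n with
    | zero => simp
    | succ n ih => rw [hx, ih, birkhoffSum_succ, add_assoc]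
  have hret : ∀ᵐ x ∂μ, ∀ N : ℕ, g x ≤ N → ∃ᶠ n in atTop, g (τ^[n] x) ≤ N :=
    ae_all_iff.2 fun N => hτ.conservative.ae_mem_imp_frequently_image_mem
      (measurableSet_le hgm measurable_const).nullMeasurableSet
  obtain ⟨x, hx, hxall, hxret⟩ := (htend.and (hall.and hret)).exists
  obtain ⟨N, hN⟩ := exists_nat_ge (g x)
  refine hxret N hN ?_
  filter_upwards [hx.eventually_gt_atTop (N - g x)] with n hn
  rw [hxall]
  linarith

/-- A jointly measurable measure-preserving action of `ℝ`. -/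
structure IsMeasurableFlow {X : Type*} [MeasurableSpace X] (T : ℝ → X → X) (μ : Measure X) :
    Prop where
  zero : T 0 = id
  add (s t : ℝ) : T (s + t) = T s ∘ T t
  measurePreserving (t : ℝ) : MeasurePreserving (T t) μ μ
  measurable : Measurable fun p : ℝ × X => T p.1 p.2

/-- The integral of `f` along the orbit of `x` from time `0` to time `t`. -/
noncomputable def orbitIntegral {X : Type*} (T : ℝ → X → X) (f : X → ℝ) (t : ℝ) (x : X) : ℝ :=
  ∫ s in (0:ℝ)..t, f (T s x)

/-- `f` is locally integrable along the orbit of `x`. -/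
def OrbitIntegrable {X : Type*} (T : ℝ → X → X) (f : X → ℝ) (x : X) : Prop :=
  ∀ a b : ℝ, IntervalIntegrable (fun s => f (T s x)) volume a b

theorem OrbitIntegrable.continuous {X : Type*} {T : ℝ → X → X} {f : X → ℝ} {x : X}
    (h : OrbitIntegrable T f x) : Continuous fun t => orbitIntegral T f t x :=
  intervalIntegral.continuous_primitive h 0

/-- If the orbit integral at `x` is nonpositive and nonnegative at arbitrarily large times, then it
vanishes at arbitrarily large times. -/
theorem OrbitIntegrable.exists_seq_orbitIntegral_eq_zero {X : Type*} {T : ℝ → X → X} {f : X → ℝ}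
    {x : X} (h : OrbitIntegrable T f x) (hle : ∃ᶠ t in atTop, orbitIntegral T f t x ≤ 0)
    (hge : ∃ᶠ t in atTop, 0 ≤ orbitIntegral T f t x) :
    ∃ t : ℕ → ℝ, Tendsto t atTop atTop ∧ ∀ k, orbitIntegral T f (t k) x = 0 := by
  have key (k : ℕ) : ∃ t : ℝ, (k : ℝ) ≤ t ∧ orbitIntegral T f t x = 0 := by
    obtain ⟨a, hka, ha⟩ := frequently_atTop.1 hle k
    obtain ⟨b, hkb, hb⟩ := frequently_atTop.1 hge k
    exact isPreconnected_Ici.intermediate_value (Set.mem_Ici.2 hka) (Set.mem_Ici.2 hkb)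
      h.continuous.continuousOn ⟨ha, hb⟩
  choose t ht hzero using key
  exact ⟨t, tendsto_atTop_mono ht tendsto_natCast_atTop_atTop, hzero⟩

namespace IsMeasurableFlow

variable {X : Type*} [MeasurableSpace X] {μ : Measure X} {T : ℝ → X → X} {f : X → ℝ} {x : X}

theorem apply_add (hT : IsMeasurableFlow T μ) (s t : ℝ) (x : X) : T (s + t) x = T s (T t x) :=
  congrFun (hT.add s t) x

theorem iterate_one (hT : IsMeasurableFlow T μ) (n : ℕ) (x : X) : (T 1)^[n] x = T n x := by
  induction n with
  | zero => simp [hT.zero]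
  | succ n ih =>
    rw [Function.iterate_succ_apply', ih, ← hT.apply_add, Nat.cast_succ, add_comm]

theorem orbitIntegrable_apply (hT : IsMeasurableFlow T μ) (h : OrbitIntegrable T f x) (t : ℝ) :
    OrbitIntegrable T f (T t x) := by
  intro a b
  simpa [hT.apply_add] using (h (a + t) (b + t)).comp_add_right t

theorem orbitIntegral_add (hT : IsMeasurableFlow T μ) (h : OrbitIntegrable T f x) (s t : ℝ) :
    orbitIntegral T f (s + t) x = orbitIntegral T f s (T t x) + orbitIntegral T f t x := by
  simp only [orbitIntegral, ← hT.apply_add]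
  rw [intervalIntegral.integral_comp_add_right (fun s => f (T s x)) t, zero_add,
    add_comm (∫ s in t..s + t, _), intervalIntegral.integral_add_adjacent_intervals (h 0 t) (h t (s + t))]

theorem birkhoffSum_orbitIntegral (hT : IsMeasurableFlow T μ) (h : OrbitIntegrable T f x)
    (n : ℕ) : birkhoffSum (T 1) (orbitIntegral T f 1) n x = orbitIntegral T f n x := by
  induction n with
  | zero => simp [orbitIntegral]
  | succ n ih =>
    rw [birkhoffSum_succ, ih, hT.iterate_one, Nat.cast_succ, add_comm (n : ℝ) 1,
      hT.orbitIntegral_add h, add_comm]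

theorem tendsto_orbitIntegral_apply_iff (hT : IsMeasurableFlow T μ) (h : OrbitIntegrable T f x)
    (t : ℝ) : Tendsto (fun s => orbitIntegral T f s (T t x)) atTop atTop ↔
      Tendsto (fun s => orbitIntegral T f s x) atTop atTop := by
  have h1 : (fun s => orbitIntegral T f s x) ∘ (fun s => s + t) =
      fun s => orbitIntegral T f s (T t x) + orbitIntegral T f t x :=
    funext fun s => hT.orbitIntegral_add h s t
  have h2 : Tendsto (fun s => orbitIntegral T f s x) atTop atTop ↔
      Tendsto ((fun s => orbitIntegral T f s x) ∘ (fun s => s + t)) atTop atTop := by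
    rw [← tendsto_map'_iff, map_add_atTop_eq]
  rw [h2, h1]
  refine ⟨tendsto_atTop_add_const_right _ _, fun h3 => ?_⟩
  simpa using tendsto_atTop_add_const_right _ (-orbitIntegral T f t x) h3

theorem measurable_orbitIntegral (hT : IsMeasurableFlow T μ) (hf : Measurable f) (t : ℝ) :
    Measurable (orbitIntegral T f t) := by
  have h (ν : Measure ℝ) [SFinite ν] : Measurable fun x => ∫ s, f (T s x) ∂ν :=
    (StronglyMeasurable.integral_prod_right (f := fun x s => f (T s x))
      (hf.comp (hT.measurable.comp measurable_swap)).stronglyMeasurable).measurable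
  exact (h _).sub (h _)

section FiniteMeasure

variable [IsFiniteMeasure μ]

theorem measurePreserving_skew (hT : IsMeasurableFlow T μ) (ν : Measure ℝ) [SFinite ν] :
    MeasurePreserving (fun p : ℝ × X => (p.1, T p.1 p.2)) (ν.prod μ) (ν.prod μ) :=
  (MeasurePreserving.id ν).skew_product hT.measurable
    (ae_of_all _ fun t => (hT.measurePreserving t).map_eq)

theorem ae_ae_eq (hT : IsMeasurableFlow T μ) {g : X → ℝ} (hfg : f =ᵐ[μ] g) :
    ∀ᵐ x ∂μ, (fun s => f (T s x)) =ᵐ[volume] fun s => g (T s x) := by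
  have h1 : ∀ᵐ p : ℝ × X ∂(volume.prod μ), f (T p.1 p.2) = g (T p.1 p.2) :=
    (Measure.quasiMeasurePreserving_snd.comp
      (hT.measurePreserving_skew volume).quasiMeasurePreserving).ae hfg
  exact Measure.ae_ae_of_ae_prod
    ((Measure.measurePreserving_swap (μ := μ) (ν := volume)).quasiMeasurePreserving.ae h1)

theorem integrable_prod (hT : IsMeasurableFlow T μ) (hf : Integrable f μ) (ν : Measure ℝ)
    [IsFiniteMeasure ν] : Integrable (fun p : ℝ × X => f (T p.1 p.2)) (ν.prod μ) :=
  (hT.measurePreserving_skew ν).integrable_comp_of_integrable (hf.comp_snd ν)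

theorem ae_orbitIntegrable (hT : IsMeasurableFlow T μ) (hf : Integrable f μ) :
    ∀ᵐ x ∂μ, OrbitIntegrable T f x := by
  have h1 : ∀ᵐ x ∂μ, ∀ n : ℕ,
      IntegrableOn (fun s => f (T s x)) (Set.Icc (-(n : ℝ)) n) volume :=
    ae_all_iff.2 fun n => (hT.integrable_prod hf _).prod_left_ae
  filter_upwards [h1] with x hx a b
  obtain ⟨n, hn⟩ := exists_nat_ge (max |a| |b|)
  obtain ⟨ha, hb⟩ := max_le_iff.1 hn
  rw [abs_le] at ha hb
  exact ((hx n).mono_set (Set.uIcc_subset_Icc ha hb)).intervalIntegrable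

theorem integrable_orbitIntegral (hT : IsMeasurableFlow T μ) (hf : Integrable f μ) (t : ℝ) :
    Integrable (orbitIntegral T f t) μ :=
  (hT.integrable_prod hf _).integral_prod_right.sub (hT.integrable_prod hf _).integral_prod_right

theorem integral_orbitIntegral (hT : IsMeasurableFlow T μ) (hf : Integrable f μ)
    {t : ℝ} (ht : 0 ≤ t) : ∫ x, orbitIntegral T f t x ∂μ = t * ∫ x, f x ∂μ := by
  have h1 (s : ℝ) : ∫ x, f (T s x) ∂μ = ∫ x, f x ∂μ := by
    have := integral_map (μ := μ) (hT.measurePreserving s).measurable.aemeasurable (f := f)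
      ((hT.measurePreserving s).map_eq.symm ▸ hf.aestronglyMeasurable)
    rw [(hT.measurePreserving s).map_eq] at this
    exact this.symm
  simp only [orbitIntegral, intervalIntegral.integral_of_le ht]
  rw [← integral_integral_swap (f := fun s x => f (T s x)) (hT.integrable_prod hf _)]
  simp [h1, ht]

end FiniteMeasure

/-- The orbit integrals of a function of zero mean along an ergodic flow almost surely do not tend
to `∞`. -/
theorem ae_not_tendsto_orbitIntegral [IsProbabilityMeasure μ] (hT : IsMeasurableFlow T μ)
    (herg : ∀ E : Set X, MeasurableSet E → (∀ t : ℝ, T t ⁻¹' E =ᵐ[μ] E) → μ E = 0 ∨ μ E = 1)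
    (hfm : Measurable f) (hf : Integrable f μ) (hf0 : ∫ x, f x ∂μ = 0) :
    ∀ᵐ x ∂μ, ¬ Tendsto (fun t => orbitIntegral T f t x) atTop atTop := by
  let E : Set X := {x | ∀ N : ℕ, ∃ M : ℕ, ∀ q : ℚ, (M : ℝ) ≤ q → (N : ℝ) ≤ orbitIntegral T f q x}
  have hE : MeasurableSet E := by
    simp only [E, Set.ofPred_forall, Set.ofPred_exists]
    exact .iInter fun N => .iUnion fun M => .iInter fun q => .iInter fun _ =>
      measurableSet_le measurable_const (hT.measurable_orbitIntegral hfm q)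
  have hmem {x : X} (hx : OrbitIntegrable T f x) :
      x ∈ E ↔ Tendsto (fun t => orbitIntegral T f t x) atTop atTop := by
    constructor
    · intro h
      refine tendsto_atTop.2 fun b => ?_
      obtain ⟨N, hN⟩ := exists_nat_ge b
      obtain ⟨M, hM⟩ := h N
      filter_upwards [eventually_gt_atTop (M : ℝ)] with t ht
      refine hN.trans ?_
      by_contra! hlt
      obtain ⟨q, hq, hqM⟩ := Rat.denseRange_cast.exists_mem_open
        ((isOpen_lt hx.continuous continuous_const).inter isOpen_Ioi) ⟨t, hlt, ht⟩
      exact absurd (hM q (le_of_lt hqM)) (not_le.2 hq)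
    · intro h N
      obtain ⟨a, ha⟩ := eventually_atTop.1 (h.eventually_ge_atTop (N : ℝ))
      obtain ⟨M, hM⟩ := exists_nat_ge a
      exact ⟨M, fun q hq => ha q (hM.trans hq)⟩
  have hgood := hT.ae_orbitIntegrable hf
  have hinv (t : ℝ) : T t ⁻¹' E =ᵐ[μ] E := by
    filter_upwards [hgood] with x hx
    refine propext ?_
    change T t x ∈ E ↔ x ∈ E
    rw [hmem hx, hmem (hT.orbitIntegrable_apply hx t), hT.tendsto_orbitIntegral_apply_iff hx]
  rcases herg E hE hinv with h | h
  · filter_upwards [hgood, measure_eq_zero_iff_ae_notMem.1 h] with x hx hxE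
    rwa [← hmem hx]
  · exfalso
    refine (hT.measurePreserving 1).not_ae_tendsto_birkhoffSum
      (hT.measurable_orbitIntegral hfm 1) (hT.integrable_orbitIntegral hf 1)
      (by rw [hT.integral_orbitIntegral hf zero_le_one, hf0, mul_zero]) ?_
    filter_upwards [hgood, (mem_ae_iff_prob_eq_one hE).2 h] with x hx hxE
    simp only [hT.birkhoffSum_orbitIntegral hx]
    exact ((hmem hx).1 hxE).comp tendsto_natCast_atTop_atTop

/-- The orbit integrals of a function of zero mean along an ergodic flow are almost surely
nonpositive at arbitrarily large times. -/
theorem ae_frequently_orbitIntegral_nonpos [IsProbabilityMeasure μ] (hT : IsMeasurableFlow T μ)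
    (herg : ∀ E : Set X, MeasurableSet E → (∀ t : ℝ, T t ⁻¹' E =ᵐ[μ] E) → μ E = 0 ∨ μ E = 1)
    (hfm : Measurable f) (hf : Integrable f μ) (hf0 : ∫ x, f x ∂μ = 0) :
    ∀ᵐ x ∂μ, ∃ᶠ t in atTop, orbitIntegral T f t x ≤ 0 := by
  let L : X → ℝ := fun x => liminf (fun q : ℚ => orbitIntegral T f q x) atTop
  have hL : Measurable L :=
    Measurable.liminf' (fun q => hT.measurable_orbitIntegral hfm q)
      (atTop_hasCountableBasis_of_archimedean (R := ℚ)) fun _ => Set.to_countable _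
  have hret {S : Set ℝ} (hS : MeasurableSet S) :
      ∀ᵐ x ∂μ, L x ∈ S → ∃ᶠ n : ℕ in atTop, L (T n x) ∈ S := by
    filter_upwards [(hT.measurePreserving 1).conservative.ae_mem_imp_frequently_image_mem
      (hL hS).nullMeasurableSet] with x hx hxS
    simpa only [hT.iterate_one, Set.mem_preimage] using hx hxS
  have hretgt : ∀ᵐ x ∂μ, ∀ c : ℚ, (c : ℝ) < L x → ∃ᶠ n : ℕ in atTop, (c : ℝ) < L (T n x) :=
    ae_all_iff.2 fun c => hret measurableSet_Ioi
  filter_upwards [hT.ae_orbitIntegrable hf, hT.ae_not_tendsto_orbitIntegral herg hfm hf hf0,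
    hretgt, hret (measurableSet_singleton 0)] with x hx hnot hgt hzero
  by_contra hpos
  simp only [not_frequently, not_le] at hpos
  have hposq : ∀ᶠ q : ℚ in atTop, 0 < orbitIntegral T f q x :=
    tendsto_ratCast_atTop_iff.2 tendsto_id |>.eventually hpos
  have hposn : ∀ᶠ n : ℕ in atTop, 0 < orbitIntegral T f n x :=
    tendsto_natCast_atTop_atTop.eventually hpos
  have hbelow : IsBoundedUnder (· ≥ ·) atTop fun q : ℚ => orbitIntegral T f q x :=
    isBoundedUnder_of_eventually_ge (hposq.mono fun _ => le_of_lt)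
  have hfreq : ∃ b : ℝ, ∃ᶠ q : ℚ in atTop, orbitIntegral T f q x ≤ b := by
    by_contra! hcon
    refine hnot (tendsto_atTop.2 fun b => ?_)
    have h1 := hcon b
    obtain ⟨M, hM⟩ := eventually_atTop.1 h1
    filter_upwards [eventually_gt_atTop (M : ℝ)] with t ht
    by_contra! hlt
    obtain ⟨q, hq, hqM⟩ := Rat.denseRange_cast.exists_mem_open
      ((isOpen_lt hx.continuous continuous_const).inter isOpen_Ioi) ⟨t, hlt, ht⟩
    have hqM' : M ≤ q := by exact_mod_cast (Set.mem_Ioi.1 hqM).le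
    exact lt_asymm (hM q hqM') hq
  obtain ⟨b, hb⟩ := hfreq
  have habove : IsCoboundedUnder (· ≥ ·) atTop fun q : ℚ => orbitIntegral T f q x :=
    IsCoboundedUnder.of_frequently_le hb
  have hshift (n : ℕ) : L (T n x) = L x - orbitIntegral T f n x := by
    have h1 : (fun q : ℚ => orbitIntegral T f q x + -orbitIntegral T f n x) ∘ (fun q => q + n) =
        fun q : ℚ => orbitIntegral T f q (T n x) := by
      funext q
      simp only [Function.comp_apply, Rat.cast_add, Rat.cast_natCast, hT.orbitIntegral_add hx]
      ring
    have h2 : L (T n x) = liminf (fun q : ℚ => orbitIntegral T f q x + -orbitIntegral T f n x)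
        (map (fun q : ℚ => q + n) atTop) := by
      simp only [L, ← h1, liminf, map_map]
    rw [h2, map_add_atTop_eq, liminf_add_const _ _ _ habove hbelow, sub_eq_add_neg]
  have hLnonneg : 0 ≤ L x := le_liminf_of_le habove (hposq.mono fun _ => le_of_lt)
  rcases hLnonneg.eq_or_lt with h0 | h0
  · refine hzero h0.symm ?_
    filter_upwards [hposn] with n hn hn0
    rw [Set.mem_singleton_iff, hshift] at hn0
    linarith
  · obtain ⟨c, hc0, hcL⟩ := exists_rat_btwn h0
    have h1 : ∀ᶠ q : ℚ in atTop, L x - c < orbitIntegral T f q x :=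
      eventually_lt_of_lt_liminf (by change _ < L x; linarith) hbelow
    refine hgt c hcL ?_
    filter_upwards [(tendsto_natCast_atTop_atTop (R := ℚ)).eventually h1] with n hn hn0
    rw [hshift] at hn0
    rw [Rat.cast_natCast] at hn
    linarith

end IsMeasurableFlow

/-- Shneiberg (continuous time): for an ergodic measure-preserving flow on a
probability space and integrable `f` with zero mean, a.e. `x` admits `t k → ∞`
with `∫_0^{t k} f(T_s x) ds = 0`. -/
theorem shneiberg_flow
    {X : Type*} [MeasurableSpace X] (μ : Measure X) [IsProbabilityMeasure μ]
    (T : ℝ → X → X)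
    (hT0 : T 0 = id)
    (hTadd : ∀ s t : ℝ, T (s + t) = T s ∘ T t)
    (hTmp : ∀ t : ℝ, MeasurePreserving (T t) μ μ)
    (hTmeas : Measurable fun p : ℝ × X => T p.1 p.2)
    (hTerg : ∀ E : Set X, MeasurableSet E → (∀ t : ℝ, T t ⁻¹' E =ᵐ[μ] E) →
      μ E = 0 ∨ μ E = 1)
    (f : X → ℝ) (hf : Integrable f μ) (hf0 : ∫ x, f x ∂μ = 0) :
    ∀ᵐ x ∂μ, ∃ t : ℕ → ℝ, Tendsto t atTop atTop ∧
      ∀ k : ℕ, (∫ s in (0:ℝ)..(t k), f (T s x)) = 0 := by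
  have hT : IsMeasurableFlow T μ := ⟨hT0, hTadd, hTmp, hTmeas⟩
  obtain ⟨g, hgm, hfg⟩ := hf.aestronglyMeasurable
  have hg : Integrable g μ := hf.congr hfg
  have hg0 : ∫ x, g x ∂μ = 0 := (integral_congr_ae hfg).symm.trans hf0
  filter_upwards [hT.ae_ae_eq hfg, hT.ae_orbitIntegrable hg,
    hT.ae_frequently_orbitIntegral_nonpos hTerg hgm.measurable hg hg0,
    hT.ae_frequently_orbitIntegral_nonpos hTerg hgm.measurable.neg hg.neg
      (by simp [integral_neg, hg0])] with x hxfg hx hle hge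
  obtain ⟨t, ht, hzero⟩ := hx.exists_seq_orbitIntegral_eq_zero hle
    (by simpa [orbitIntegral] using hge)
  refine ⟨t, ht, fun k => ?_⟩
  exact (intervalIntegral.integral_congr_ae (hxfg.mono fun s hs _ => hs)).trans (hzero k)
end

section
/- (Local Wiener theorem) Let (T_t)_{t∈ℝ} be a measurable measure-preserving flow on a probability space (X,μ) and let f : X → ℝ be integrable. Then for μ-almost every x ∈ X one has (1/t) ∫_0^t f(T_s x) ds → f(x) as t → 0⁺. -/
open MeasureTheory Filter Topology

/-- A function continuous on `(0, ∞)` that converges at `0⁺` along the rationals converges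
at `0⁺`. -/
theorem tendsto_nhdsGT_zero_of_tendsto_ratCast {h : ℝ → ℝ} {L : ℝ}
    (hc : ContinuousOn h (Set.Ioi 0))
    (hq : Tendsto (fun q : ℚ => h q) (comap (fun q : ℚ => (q : ℝ)) (𝓝[>] (0 : ℝ))) (𝓝 L)) :
    Tendsto h (𝓝[>] (0 : ℝ)) (𝓝 L) := by
  rw [(closed_nhds_basis L).tendsto_right_iff]
  rintro C ⟨hCL, hC⟩
  have h1 := hq.eventually_mem hCL
  rw [eventually_comap, ((nhdsGT_basis (0 : ℝ)).eventually_iff)] at h1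
  obtain ⟨δ, hδ, h1⟩ := h1
  filter_upwards [Ioo_mem_nhdsGT hδ] with t ht
  by_contra hcon
  have h2 : ∀ᶠ u in 𝓝 t, h u ∉ C :=
    (hc.continuousAt (Ioi_mem_nhds ht.1)).eventually_mem (hC.isOpen_compl.mem_nhds hcon)
  have h3 : ∀ᶠ u in 𝓝 t, u ∈ Set.Ioo 0 δ := Ioo_mem_nhds ht.1 ht.2
  obtain ⟨_, ⟨q, rfl⟩, hu2, hu3⟩ := (Rat.denseRange_cast (𝕜 := ℝ)).inter_nhds_nonempty
    (h2.and h3)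
  exact hu2 (h1 hu3 q rfl)

/-- Along a locally integrable orbit, the averages converge at almost every time. -/
theorem ae_tendsto_flow_average {X : Type*} {T : ℝ → X → X}
    (hTadd : ∀ s t : ℝ, T (s + t) = T s ∘ T t) {g : X → ℝ} {x : X}
    (hx : LocallyIntegrable (fun s => g (T s x)) volume) :
    ∀ᵐ r : ℝ, Tendsto (fun t : ℝ => (1 / t) * ∫ s in (0:ℝ)..t, g (T s (T r x)))
      (𝓝[>] (0:ℝ)) (𝓝 (g (T r x))) := by
  have hi (a b : ℝ) : IntervalIntegrable (fun s => g (T s x)) volume a b :=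
    intervalIntegrable_iff.mpr <|
      (hx.integrableOn_isCompact isCompact_uIcc).mono_set Set.uIoc_subset_uIcc
  filter_upwards [_root_.LocallyIntegrable.ae_hasDerivAt_integral hx] with r hr
  refine ((hr 0).tendsto_slope_zero_right).congr fun t => ?_
  have h1 : ∀ s, T s (T r x) = T (s + r) x := fun s => by rw [hTadd]; rfl
  simp only [h1, smul_eq_mul, one_div]
  rw [intervalIntegral.integral_interval_sub_left (hi _ _) (hi _ _),
    intervalIntegral.integral_comp_add_right (fun s => g (T s x)), zero_add, add_comm]

section Flow

variable {X : Type*} [MeasurableSpace X] {μ : Measure X} {T : ℝ → X → X}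

/-- The shear `(s, x) ↦ (s, T_s x)` preserves the product measure. -/
theorem measurePreserving_flow_shear [SFinite μ] (ν : Measure ℝ) [SFinite ν]
    (hTmp : ∀ t : ℝ, MeasurePreserving (T t) μ μ)
    (hTmeas : Measurable fun p : ℝ × X => T p.1 p.2) :
    MeasurePreserving (fun p : ℝ × X => (p.1, T p.1 p.2)) (ν.prod μ) (ν.prod μ) :=
  (MeasurePreserving.id ν).skew_product (g := T) hTmeas (.of_forall fun t => (hTmp t).map_eq)

/-- Almost every orbit of an integrable function is locally integrable in time. -/
theorem ae_locallyIntegrable_flow [SFinite μ]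
    (hTmp : ∀ t : ℝ, MeasurePreserving (T t) μ μ)
    (hTmeas : Measurable fun p : ℝ × X => T p.1 p.2)
    {g : X → ℝ} (hg : Integrable g μ) :
    ∀ᵐ x ∂μ, LocallyIntegrable (fun s => g (T s x)) volume := by
  have h (n : ℕ) : ∀ᵐ x ∂μ, IntegrableOn (fun s => g (T s x)) (Set.Icc (-n : ℝ) n) volume :=
    ((measurePreserving_flow_shear (volume.restrict (Set.Icc (-n : ℝ) n)) hTmp
      hTmeas).integrable_comp_of_integrable (hg.comp_snd _)).prod_left_ae
  filter_upwards [ae_all_iff.2 h] with x hx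
  rw [locallyIntegrable_iff]
  intro K hK
  obtain ⟨r, hr⟩ := hK.isBounded.subset_closedBall 0
  obtain ⟨n, hn⟩ := exists_nat_ge r
  refine (hx n).mono_set (hr.trans ?_)
  rw [Real.closedBall_eq_Icc]
  exact Set.Icc_subset_Icc (by linarith) (by linarith)

/-- The local ergodic theorem for a measurable integrable function. -/
theorem ae_tendsto_flow_average_of_measurable [SFinite μ]
    (hTadd : ∀ s t : ℝ, T (s + t) = T s ∘ T t)
    (hTmp : ∀ t : ℝ, MeasurePreserving (T t) μ μ)
    (hTmeas : Measurable fun p : ℝ × X => T p.1 p.2)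
    {g : X → ℝ} (hgm : Measurable g) (hg : Integrable g μ) :
    ∀ᵐ x ∂μ, Tendsto (fun t : ℝ => (1 / t) * ∫ s in (0:ℝ)..t, g (T s x))
      (𝓝[>] (0:ℝ)) (𝓝 (g x)) := by
  have hloc := ae_locallyIntegrable_flow hTmp hTmeas hg
  let G : Set X := {x | Tendsto (fun q : ℚ => (1 / (q : ℝ)) * ∫ s in (0:ℝ)..q, g (T s x))
    (comap (fun q : ℚ => (q : ℝ)) (𝓝[>] (0 : ℝ))) (𝓝 (g x))}
  have hmeas (t : ℝ) : Measurable fun x => ∫ s in (0:ℝ)..t, g (T s x) := by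
    have hsm : StronglyMeasurable fun p : ℝ × X => g (T p.1 p.2) :=
      (hgm.comp hTmeas).stronglyMeasurable
    simp only [intervalIntegral]
    exact (hsm.integral_prod_left'.sub hsm.integral_prod_left').measurable
  have hG : MeasurableSet G :=
    measurableSet_tendsto_fun (ι := ℚ) (fun q => (hmeas q).const_mul _) hgm
  have hGae : ∀ᵐ x ∂μ, x ∈ G := by
    have h1 : ∀ᵐ x ∂μ, ∀ᵐ r : ℝ, T r x ∈ G := by
      filter_upwards [hloc] with x hx
      filter_upwards [ae_tendsto_flow_average hTadd hx] with r hr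
      exact hr.comp tendsto_comap
    rw [← Measure.ae_ae_comm (p := fun r x => T r x ∈ G) (hTmeas hG)] at h1
    obtain ⟨r, hr⟩ := h1.exists
    rw [← (hTmp r).map_eq]
    exact (ae_map_iff (hTmp r).aemeasurable hG).2 hr
  filter_upwards [hloc, hGae] with x hx hxG
  refine tendsto_nhdsGT_zero_of_tendsto_ratCast ?_ hxG
  have hcont : Continuous fun t : ℝ => ∫ s in (0:ℝ)..t, g (T s x) :=
    intervalIntegral.continuous_primitive (fun a b => intervalIntegrable_iff.mpr <|
      (hx.integrableOn_isCompact isCompact_uIcc).mono_set Set.uIoc_subset_uIcc) 0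
  exact (continuousOn_const.div continuousOn_id fun t ht => (Set.mem_Ioi.1 ht).ne').mul
    hcont.continuousOn

end Flow

/-- Local Wiener theorem: for a measurable measure-preserving flow on a probability
space and integrable `f`, for a.e. `x` one has `(1/t) ∫_0^t f(T_s x) ds → f x`
as `t → 0⁺`. -/
theorem local_wiener
    {X : Type*} [MeasurableSpace X] (μ : Measure X) [IsProbabilityMeasure μ]
    (T : ℝ → X → X)
    (hT0 : T 0 = id)
    (hTadd : ∀ s t : ℝ, T (s + t) = T s ∘ T t)
    (hTmp : ∀ t : ℝ, MeasurePreserving (T t) μ μ)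
    (hTmeas : Measurable fun p : ℝ × X => T p.1 p.2)
    (f : X → ℝ) (hf : Integrable f μ) :
    ∀ᵐ x ∂μ,
      Tendsto (fun t : ℝ => (1 / t) * ∫ s in (0:ℝ)..t, f (T s x))
        (𝓝[>] (0:ℝ)) (𝓝 (f x)) := by
  obtain ⟨g, hgm, hfg⟩ := hf.aestronglyMeasurable
  have horb : ∀ᵐ x ∂μ, ∀ᵐ s : ℝ, f (T s x) = g (T s x) := by
    have h1 : ∀ᵐ p ∂((volume : Measure ℝ).prod μ), f (T p.1 p.2) = g (T p.1 p.2) :=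
      (measurePreserving_flow_shear volume hTmp hTmeas).quasiMeasurePreserving.ae
        (Measure.quasiMeasurePreserving_snd.ae hfg)
    exact Measure.ae_ae_of_ae_prod
      (Measure.measurePreserving_swap.quasiMeasurePreserving.ae h1)
  filter_upwards [horb, hfg, ae_tendsto_flow_average_of_measurable hTadd hTmp hTmeas
    hgm.measurable (hf.congr hfg)] with x hx hfx hlim
  rw [hfx]
  refine hlim.congr fun t => ?_
  rw [intervalIntegral.integral_congr_ae (hx.mono fun s hs _ => hs)]
end

section
/- (Denisova) Let X be a compact metric space, let (T_t)_{t∈ℝ} be a jointly continuous flow on X preserving a Borel probability measure μ with respect to which it is ergodic, and let f : X → ℝ be continuous with ∫_X f dμ = 0. Then for μ-almost every x with f(x) ≠ 0 there exists a sequence t_k → ∞ such that ∫_0^{t_k} f(T_s x) ds = 0 and T_{t_k} x → x as k → ∞. -/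
open MeasureTheory Filter Topology

/-- A finite family of reals in `[-R, R]` with mutual distances at least `ε` has at most
`2 * R / ε + 1` members. -/
lemma Finset.card_le_of_abs_le_of_separated (s : Finset ℕ) (v : ℕ → ℝ) {R ε : ℝ} (hε : 0 < ε)
    (hR : 0 ≤ R) (hv : ∀ i ∈ s, |v i| ≤ R)
    (hsep : ∀ i ∈ s, ∀ j ∈ s, i < j → ε ≤ |v j - v i|) :
    (s.card : ℝ) ≤ 2 * R / ε + 1 := by
  have hpos : ∀ i ∈ s, 0 ≤ (v i + R) / ε := fun i hi =>
    div_nonneg (by linarith [neg_le_of_abs_le (hv i hi)]) hε.le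
  have hinj : Set.InjOn (fun i => ⌊(v i + R) / ε⌋₊) s := by
    have key : ∀ i ∈ s, ∀ j ∈ s, i < j → ⌊(v i + R) / ε⌋₊ ≠ ⌊(v j + R) / ε⌋₊ := by
      intro i hi j hj hij heq
      have hd : |(v j + R) / ε - (v i + R) / ε| < 1 := by
        have h1 := Nat.floor_le (hpos i hi)
        have h2 := Nat.lt_floor_add_one ((v i + R) / ε)
        have h3 := Nat.floor_le (hpos j hj)
        have h4 := Nat.lt_floor_add_one ((v j + R) / ε)
        rw [heq] at h1 h2
        rw [abs_lt]
        constructor <;> linarith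
      rw [← sub_div, abs_div, abs_of_pos hε, div_lt_one hε, add_sub_add_right_eq_sub] at hd
      exact absurd (hsep i hi j hj hij) (not_le.2 hd)
    intro i hi j hj heq
    by_contra hne
    rcases lt_or_gt_of_ne hne with h | h
    · exact key i hi j hj h heq
    · exact key j hj i hi h heq.symm
  have hmaps : Set.MapsTo (fun i => ⌊(v i + R) / ε⌋₊) s
      (Finset.range (⌊2 * R / ε⌋₊ + 1) : Finset ℕ) := by
    intro i hi
    simp only [Finset.coe_range, Set.mem_Iio, Nat.lt_succ_iff]
    refine Nat.floor_le_floor ?_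
    gcongr
    linarith [le_of_abs_le (hv i hi)]
  have hcard := Finset.card_le_card_of_injOn _ hmaps hinj
  rw [Finset.card_range] at hcard
  calc (s.card : ℝ) ≤ ((⌊2 * R / ε⌋₊ + 1 : ℕ) : ℝ) := by exact_mod_cast hcard
    _ ≤ 2 * R / ε + 1 := by
      push_cast
      gcongr
      exact Nat.floor_le (by positivity)

/-- Visits of an orbit to a set `B` from which the orbit never returns to `B` with a Birkhoff sum
smaller than `ε` are rare, up to the times where the Birkhoff averages exceed `δ`. -/
lemma sum_indicator_iterate_le {X : Type*} (φ : X → X) (a : X → ℝ) {B : Set X} {ε δ : ℝ}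
    (hε : 0 < ε) (hδ : 0 < δ)
    (hB : ∀ x ∈ B, ∀ n : ℕ, 1 ≤ n → φ^[n] x ∈ B → ε ≤ |birkhoffSum φ a n x|) (N : ℕ) (x : X) :
    ∑ n ∈ Finset.range N, B.indicator (fun _ => (1 : ℝ)) (φ^[n] x) ≤
      (2 * (δ * N) / ε + 1) + ∑ n ∈ Finset.range N, |birkhoffAverage ℝ φ a n x| / δ := by
  classical
  set s := (Finset.range N).filter fun n => φ^[n] x ∈ B ∧ |birkhoffSum φ a n x| ≤ δ * N with hs
  have hcard : (s.card : ℝ) ≤ 2 * (δ * N) / ε + 1 := by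
    refine s.card_le_of_abs_le_of_separated (fun n => birkhoffSum φ a n x) hε (by positivity)
      (fun i hi => (Finset.mem_filter.1 hi).2.2) fun i hi j hj hij => ?_
    have hiB := (Finset.mem_filter.1 hi).2.1
    have hjB := (Finset.mem_filter.1 hj).2.1
    obtain ⟨k, rfl⟩ := Nat.exists_eq_add_of_le hij.le
    rw [birkhoffSum_add, add_sub_cancel_left]
    refine hB _ hiB k (by omega) ?_
    rwa [← Function.iterate_add_apply, add_comm]
  have hsum : (s.card : ℝ) = ∑ n ∈ Finset.range N,
      if φ^[n] x ∈ B ∧ |birkhoffSum φ a n x| ≤ δ * N then (1 : ℝ) else 0 := by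
    rw [hs, Finset.card_filter]
    push_cast
    rfl
  refine le_trans ?_ (add_le_add_left hcard _)
  rw [hsum, ← Finset.sum_add_distrib]
  refine Finset.sum_le_sum fun n hn => ?_
  have hnonneg : 0 ≤ |birkhoffAverage ℝ φ a n x| / δ := by positivity
  by_cases hnB : φ^[n] x ∈ B
  · by_cases hle : |birkhoffSum φ a n x| ≤ δ * N
    · simp [hnB, hle, hnonneg]
    · simp only [Set.indicator_of_mem hnB, hle, and_false, if_false, zero_add]
      rw [le_div_iff₀ hδ, one_mul]
      by_contra! hlt
      refine hle ?_
      have hnN : (n : ℝ) ≤ N := by exact_mod_cast (Finset.mem_range.1 hn).le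
      rcases Nat.eq_zero_or_pos n with rfl | hpos
      · simp; positivity
      · have hn0 : (0 : ℝ) < n := by exact_mod_cast hpos
        rw [birkhoffAverage, smul_eq_mul, abs_mul, abs_inv, Nat.abs_cast,
          inv_mul_lt_iff₀ hn0] at hlt
        nlinarith
  · simp [hnB, hnonneg]

/-- If the Birkhoff averages of `a` tend to zero in mean, then almost every point of `A` returns
to `A` with an arbitrarily small Birkhoff sum. -/
lemma MeasureTheory.MeasurePreserving.ae_exists_return_birkhoffSum_lt {X : Type*}
    [MeasurableSpace X] {μ : Measure X} [IsProbabilityMeasure μ] {φ : X → X}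
    (hφ : MeasurePreserving φ μ μ) {a : X → ℝ} (ham : Measurable a) (hai : Integrable a μ)
    (hlim : Tendsto (fun n : ℕ => ∫ x, |birkhoffAverage ℝ φ a n x| ∂μ) atTop (𝓝 0))
    {A : Set X} (hA : MeasurableSet A) {ε : ℝ} (hε : 0 < ε) :
    ∀ᵐ x ∂μ, x ∈ A → ∃ n : ℕ, 1 ≤ n ∧ φ^[n] x ∈ A ∧ |birkhoffSum φ a n x| < ε := by
  have hSm : ∀ n, Measurable (birkhoffSum φ a n) := fun n =>
    Finset.measurable_fun_sum _ fun k _ => ham.comp (hφ.measurable.iterate k)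
  have hSi : ∀ n, Integrable (birkhoffSum φ a n) μ := fun n =>
    integrable_finsetSum _ fun k _ => (hφ.iterate k).integrable_comp_of_integrable hai
  have havg : ∀ n, Integrable (fun x => |birkhoffAverage ℝ φ a n x|) μ := fun n =>
    ((hSi n).smul (n : ℝ)⁻¹).abs
  set B : Set X := {x | x ∈ A ∧ ∀ n : ℕ, 1 ≤ n → φ^[n] x ∈ A → ε ≤ |birkhoffSum φ a n x|} with hBdef
  have hBm : MeasurableSet B := by
    have : B = A ∩ ⋂ n : ℕ, ⋂ _ : 1 ≤ n,
        ((φ^[n] ⁻¹' A)ᶜ ∪ {x | ε ≤ |birkhoffSum φ a n x|}) := by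
      ext x
      simp [hBdef, imp_iff_not_or]
    rw [this]
    exact hA.inter <| MeasurableSet.iInter fun n => MeasurableSet.iInter fun _ =>
      ((hφ.measurable.iterate n) hA).compl.union
        (measurableSet_le measurable_const (hSm n).abs)
  have hB : ∀ x ∈ B, ∀ n : ℕ, 1 ≤ n → φ^[n] x ∈ B → ε ≤ |birkhoffSum φ a n x| :=
    fun x hx n hn hxn => hx.2 n hn hxn.1
  have hbound : ∀ δ : ℝ, 0 < δ → μ.real B ≤ 2 * δ / ε := by
    intro δ hδ
    have hN : ∀ N : ℕ, 1 ≤ N → μ.real B ≤ 2 * δ / ε + (N : ℝ)⁻¹ +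
        ((N : ℝ)⁻¹ * ∑ n ∈ Finset.range N, ∫ x, |birkhoffAverage ℝ φ a n x| ∂μ) / δ := by
      intro N hN
      have hN0 : (0 : ℝ) < N := by exact_mod_cast hN
      have hind : ∀ n, Integrable (fun x => B.indicator (fun _ => (1 : ℝ)) (φ^[n] x)) μ := fun n =>
        (hφ.iterate n).integrable_comp_of_integrable ((integrable_const (1 : ℝ)).indicator hBm)
      have hmono := integral_mono (integrable_finsetSum (Finset.range N) fun n _ => hind n)
        ((integrable_const (2 * (δ * N) / ε + 1)).add
          (integrable_finsetSum (Finset.range N) fun n _ => (havg n).div_const δ))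
        (sum_indicator_iterate_le φ a hε hδ hB N)
      simp only [Pi.add_apply] at hmono
      rw [integral_finsetSum _ fun n _ => hind n, integral_add (integrable_const _)
        (integrable_finsetSum (Finset.range N) fun n _ => (havg n).div_const δ),
        integral_finsetSum _ fun n _ => (havg n).div_const δ] at hmono
      have hval : ∀ n, ∫ x, B.indicator (fun _ => (1 : ℝ)) (φ^[n] x) ∂μ = μ.real B := by
        intro n
        have h := integral_map (hφ.iterate n).aemeasurable (μ := μ)
          (f := B.indicator (fun _ => (1 : ℝ)))
          (measurable_const.indicator hBm).aestronglyMeasurable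
        rw [← h, (hφ.iterate n).map_eq, integral_indicator_const _ hBm]
        simp
      simp only [hval, integral_const, probReal_univ, one_smul, Finset.sum_const,
        Finset.card_range, nsmul_eq_mul, integral_div, ← Finset.sum_div] at hmono
      rw [← mul_le_mul_iff_right₀ hN0]
      refine hmono.trans (le_of_eq ?_)
      field_simp
    have ht : Tendsto (fun N : ℕ => 2 * δ / ε + (N : ℝ)⁻¹ +
        ((N : ℝ)⁻¹ * ∑ n ∈ Finset.range N, ∫ x, |birkhoffAverage ℝ φ a n x| ∂μ) / δ) atTop
        (𝓝 (2 * δ / ε + 0 + 0 / δ)) :=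
      (tendsto_const_nhds.add tendsto_inv_atTop_nhds_zero_nat).add (hlim.cesaro.div_const δ)
    rw [zero_div, add_zero, add_zero] at ht
    exact ge_of_tendsto ht ((eventually_ge_atTop 1).mono hN)
  have hB0 : μ B = 0 := by
    have hle : μ.real B ≤ 0 := by
      refine le_of_forall_pos_le_add fun η hη => ?_
      calc μ.real B ≤ 2 * (η * ε / 2) / ε := hbound _ (by positivity)
        _ = 0 + η := by field_simp; ring
    exact (measureReal_eq_zero_iff).1 (le_antisymm hle measureReal_nonneg)
  filter_upwards [measure_eq_zero_iff_ae_notMem.1 hB0] with x hx hxA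
  by_contra! hcon
  exact hx ⟨hxA, hcon⟩

/-- A flow-invariant integrable function of zero mean vanishes almost everywhere when the family
of maps is ergodic. -/
lemma ae_eq_zero_of_forall_comp_ae_eq {X ι : Type*} [MeasurableSpace X] {μ : Measure X}
    [IsProbabilityMeasure μ] {T : ι → X → X}
    (hTerg : ∀ E : Set X, MeasurableSet E → (∀ t, T t ⁻¹' E =ᵐ[μ] E) → μ E = 0 ∨ μ E = 1)
    {g : X → ℝ} (hgm : Measurable g) (hgi : Integrable g μ) (hg0 : ∫ x, g x ∂μ = 0)
    (hinv : ∀ t, g ∘ T t =ᵐ[μ] g) : g =ᵐ[μ] 0 := by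
  have nonpos : ∀ h : X → ℝ, Measurable h → Integrable h μ → ∫ x, h x ∂μ = 0 →
      (∀ t, h ∘ T t =ᵐ[μ] h) → ∀ᵐ x ∂μ, h x ≤ 0 := by
    intro h hm hi h0 hinv
    have hE : MeasurableSet {x | 0 < h x} := measurableSet_lt measurable_const hm
    rcases hTerg _ hE fun t => by
      filter_upwards [hinv t] with x hx
      exact congrArg (0 < ·) hx with hz | ho
    · filter_upwards [measure_eq_zero_iff_ae_notMem.1 hz] with x hx
      simpa using hx
    · have hpos : ∀ᵐ x ∂μ, 0 < h x := (prob_compl_eq_zero_iff hE).2 ho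
      have := (integral_eq_zero_iff_of_nonneg_ae (hpos.mono fun x hx => hx.le) hi).1 h0
      exact this.mono fun x hx => hx.le
  filter_upwards [nonpos g hgm hgi hg0 hinv,
    nonpos (-g) hgm.neg hgi.neg (by simp [integral_neg, hg0])
      fun t => (hinv t).mono fun x hx => by simpa using hx] with x h1 h2
  exact le_antisymm h1 (by simpa using h2)

/-- Iterates of the time-`M` map of a flow. -/
lemma iterate_flow {X : Type*} {T : ℝ → X → X} (hT0 : T 0 = id)
    (hTadd : ∀ s t : ℝ, T (s + t) = T s ∘ T t) (M : ℝ) (n : ℕ) : (T M)^[n] = T (n * M) := by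
  induction n with
  | zero => simp [hT0]
  | succ n ih => rw [Function.iterate_succ, ih, ← hTadd, Nat.cast_succ, add_one_mul]

/-- Birkhoff sums of a cocycle over a flow, along the time-`M` map. -/
lemma birkhoffSum_cocycle {X F : Type*} [FunLike F X ℝ] {T : ℝ → X → X} (hT0 : T 0 = id)
    (hTadd : ∀ s t : ℝ, T (s + t) = T s ∘ T t) {S : ℝ → F}
    (hS : ∀ s t x, S (s + t) x = S s x + S t (T s x)) (M : ℝ) (n : ℕ) (x : X) :
    birkhoffSum (T M) (S M) n x = S (n * M) x := by
  induction n with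
  | zero =>
    have h := hS 0 0 x
    rw [add_zero, hT0, id] at h
    simp only [birkhoffSum_zero, Nat.cast_zero, zero_mul]
    linarith
  | succ n ih =>
    rw [birkhoffSum_succ, ih, iterate_flow hT0 hTadd, ← hS, Nat.cast_succ, add_one_mul]

/-- The mean ergodic theorem for a continuous cocycle of zero mean over an ergodic flow. -/
lemma tendsto_integral_abs_birkhoffAverage_cocycle {X : Type*} [TopologicalSpace X]
    [CompactSpace X] [MeasurableSpace X] [BorelSpace X]
    {μ : Measure X} [IsProbabilityMeasure μ] {T : ℝ → X → X} (hT0 : T 0 = id)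
    (hTadd : ∀ s t : ℝ, T (s + t) = T s ∘ T t) (hTcont : ∀ t, Continuous (T t))
    (hTmp : ∀ t : ℝ, MeasurePreserving (T t) μ μ)
    (hTerg : ∀ E : Set X, MeasurableSet E → (∀ t : ℝ, T t ⁻¹' E =ᵐ[μ] E) →
      μ E = 0 ∨ μ E = 1)
    {S : ℝ → C(X, ℝ)} (hS : ∀ s t x, S (s + t) x = S s x + S t (T s x))
    (M : ℝ) (hM : ∫ x, S M x ∂μ = 0) :
    Tendsto (fun n : ℕ => ∫ x, |birkhoffAverage ℝ (T M) (S M) n x| ∂μ) atTop (𝓝 0) := by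
  have hiter := iterate_flow hT0 hTadd M
  have hbs := birkhoffSum_cocycle hT0 hTadd hS M
  have hba : ∀ n : ℕ, birkhoffAverage ℝ (T M) (S M) n = ((n : ℝ)⁻¹ • S (n * M) : C(X, ℝ)) := by
    intro n
    ext x
    simp [birkhoffAverage, hbs]
  let U (t : ℝ) : Lp ℝ 2 μ →ₗᵢ[ℝ] Lp ℝ 2 μ := Lp.compMeasurePreservingₗᵢ ℝ (T t) (hTmp t)
  let L : C(X, ℝ) →L[ℝ] Lp ℝ 2 μ := ContinuousMap.toLp 2 μ ℝ
  have hU : ∀ t (h : C(X, ℝ)), U t (L h) = L (h.comp ⟨T t, hTcont t⟩) := by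
    intro t h
    refine Lp.ext ?_
    filter_upwards [Lp.coeFn_compMeasurePreserving (L h) (hTmp t),
      ContinuousMap.coeFn_toLp (p := 2) (𝕜 := ℝ) μ (h.comp ⟨T t, hTcont t⟩),
      (hTmp t).quasiMeasurePreserving.ae (ContinuousMap.coeFn_toLp (p := 2) (𝕜 := ℝ) μ h)]
      with x h1 h2 h3
    exact h1.trans (h3.trans h2.symm)
  have hUiter : ∀ n : ℕ, (U M)^[n] (L (S M)) = L ((S M).comp ⟨T (n * M), hTcont _⟩) := by
    intro n
    induction n with
    | zero =>
      simp only [Function.iterate_zero, id]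
      congr 1
      ext x
      simp [hT0]
    | succ n ih =>
      rw [Function.iterate_succ_apply', ih, hU]
      congr 1
      ext x
      have : T (n * M) (T M x) = T ((n + 1 : ℕ) * M) x := by
        rw [← hiter, ← hiter, Function.iterate_succ_apply]
      simp [this]
  have hUavg : ∀ n : ℕ, birkhoffAverage ℝ (U M) _root_.id n (L (S M)) =
      L ((n : ℝ)⁻¹ • S (n * M)) := by
    intro n
    rw [birkhoffAverage, birkhoffSum, map_smul]
    simp only [id, hUiter, ← map_sum]
    congr 2
    ext x
    rw [← hbs, birkhoffSum, ContinuousMap.sum_apply]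
    simp [hiter]
  obtain ⟨g, hg⟩ : ∃ g, Tendsto (fun n : ℕ => L ((n : ℝ)⁻¹ • S (n * M))) atTop (𝓝 g) := by
    simp only [← hUavg]
    exact ⟨_, (U M).toContinuousLinearMap.tendsto_birkhoffAverage_orthogonalProjection
      (U M).norm_toContinuousLinearMap_le (L (S M))⟩
  have hUg : ∀ t, U t g = g := by
    intro t
    have h1 := ((U t).continuous.tendsto g).comp hg
    refine tendsto_nhds_unique h1 ?_
    have hbd : ∀ n : ℕ, ‖(U t ∘ fun n : ℕ => L ((n : ℝ)⁻¹ • S (n * M))) n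
        - L ((n : ℝ)⁻¹ • S (n * M))‖ ≤ ‖L‖ * ((n : ℝ)⁻¹ * (2 * ‖S t‖)) := by
      intro n
      rw [Function.comp_apply, hU, ← map_sub]
      refine (L.le_opNorm _).trans ?_
      gcongr
      refine (ContinuousMap.norm_le _ (by positivity)).2 fun x => ?_
      have hx : S (n * M) (T t x) - S (n * M) x = S t (T (n * M) x) - S t x := by
        have h1 := hS t (n * M) x
        have h2 := hS (n * M) t x
        rw [add_comm] at h1
        linarith
      have : ((((n : ℝ)⁻¹ • S (n * M)).comp ⟨T t, hTcont t⟩ - (n : ℝ)⁻¹ • S (n * M) :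
          C(X, ℝ))) x = (n : ℝ)⁻¹ * (S t (T (n * M) x) - S t x) := by
        rw [← hx]
        simp only [ContinuousMap.sub_apply, ContinuousMap.comp_apply, ContinuousMap.smul_apply,
          ContinuousMap.coe_mk, smul_eq_mul]
        ring
      rw [this, norm_mul, norm_inv, RCLike.norm_natCast, two_mul]
      gcongr
      exact (norm_sub_le _ _).trans
        (add_le_add ((S t).norm_coe_le_norm _) ((S t).norm_coe_le_norm _))
    have hz : Tendsto (fun n : ℕ => ‖L‖ * ((n : ℝ)⁻¹ * (2 * ‖S t‖))) atTop (𝓝 0) := by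
      simpa using (tendsto_inv_atTop_nhds_zero_nat.mul_const (2 * ‖S t‖)).const_mul ‖L‖
    have hadd := hg.add (squeeze_zero_norm hbd hz)
    rw [add_zero] at hadd
    exact hadd.congr fun n => add_sub_cancel _ _
  have hae : ∀ n : ℕ, (L ((n : ℝ)⁻¹ • S (n * M)) : X → ℝ) =ᵐ[μ]
      ((n : ℝ)⁻¹ • S (n * M) : C(X, ℝ)) := fun n => ContinuousMap.coeFn_toLp μ _
  have hgL1 : Tendsto (fun n : ℕ => eLpNorm (⇑((n : ℝ)⁻¹ • S (n * M) : C(X, ℝ)) - ⇑g) 1 μ)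
      atTop (𝓝 0) := by
    refine tendsto_of_tendsto_of_tendsto_of_le_of_le tendsto_const_nhds
      ((Lp.tendsto_Lp_iff_tendsto_eLpNorm' _ _).1 hg) (fun _ => bot_le) fun n => ?_
    rw [eLpNorm_congr_ae ((hae n).sub (ae_eq_refl g))]
    exact eLpNorm_le_eLpNorm_of_exponent_le (by norm_num)
      ((ContinuousMap.continuous _).aestronglyMeasurable.sub (Lp.aestronglyMeasurable g))
  have hgi : Integrable g μ := (Lp.memLp g).integrable (by norm_num)
  have hSint : ∀ h : C(X, ℝ), Integrable h μ := fun h =>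
    (h.memLp (p := 1) (μ := μ) ℝ).integrable le_rfl
  have hmean : ∀ n : ℕ, ∫ x, ((n : ℝ)⁻¹ • S (n * M) : C(X, ℝ)) x ∂μ = 0 := by
    intro n
    simp only [ContinuousMap.smul_apply, ← hbs, integral_smul, birkhoffSum]
    rw [integral_finsetSum (f := fun k x => S M ((T M)^[k] x)) _ fun k _ =>
      ((hTmp M).iterate k).integrable_comp_of_integrable (hSint (S M)), Finset.sum_eq_zero, smul_zero]
    intro k _
    have h := integral_map ((hTmp M).iterate k).aemeasurable (f := S M)
      (S M).continuous.aestronglyMeasurable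
    rw [← h, ((hTmp M).iterate k).map_eq, hM]
  have hg0 : ∫ x, g x ∂μ = 0 := by
    have h := tendsto_integral_of_L1' g hgi.aestronglyMeasurable
      (Eventually.of_forall fun n : ℕ => hSint _) hgL1
    simp only [hmean] at h
    exact tendsto_nhds_unique h tendsto_const_nhds
  have hgz : g =ᵐ[μ] 0 := by
    refine ae_eq_zero_of_forall_comp_ae_eq hTerg (Lp.stronglyMeasurable g).measurable hgi hg0
      fun t => ?_
    have h := Lp.coeFn_compMeasurePreserving g (hTmp t)
    exact h.symm.trans (by rw [show Lp.compMeasurePreserving (T t) (hTmp t) g = g from hUg t])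
  have habs := fun n : ℕ => eLpNorm_congr_ae (p := 1)
    ((ae_eq_refl (((n : ℝ)⁻¹ • S (n * M) : C(X, ℝ)) : X → ℝ)).sub hgz)
  simp only [habs, sub_zero] at hgL1
  have hreal := (ENNReal.tendsto_toReal ENNReal.zero_ne_top).comp hgL1
  refine (hreal.congr fun n => ?_)
  rw [hba, Function.comp_apply, eLpNorm_one_eq_lintegral_enorm]
  exact (integral_norm_eq_lintegral_enorm
    (ContinuousMap.continuous _).aestronglyMeasurable).symm

/-- If a continuous function stays within `|c| / 2` of `c` on `[-δ, δ]`, then its primitives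
that are small at `0` vanish somewhere on `[-δ, δ]`. -/
lemma exists_add_intervalIntegral_eq_zero {q : ℝ → ℝ} (hq : Continuous q) {c δ σ : ℝ}
    (hδ : 0 < δ) (hqc : ∀ v, |v| ≤ δ → |q v - c| ≤ |c| / 2) (hσ : |σ| ≤ |c| / 2 * δ) :
    ∃ u, |u| ≤ δ ∧ σ + ∫ v in (0 : ℝ)..u, q v = 0 := by
  have hcont : Continuous fun u => σ + ∫ v in (0 : ℝ)..u, q v :=
    continuous_const.add (intervalIntegral.continuous_primitive
      (fun _ _ => hq.intervalIntegrable _ _) 0)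
  have hest : ∀ u, |u| ≤ δ → |(∫ v in (0 : ℝ)..u, q v) - u * c| ≤ |c| / 2 * |u| := by
    intro u hu
    have h := intervalIntegral.norm_integral_le_of_norm_le_const (a := 0) (b := u)
      (f := fun v => q v - c) (C := |c| / 2) fun v hv => hqc v (by
        have := Set.abs_sub_left_of_mem_uIcc (Set.uIoc_subset_uIcc hv)
        simp only [sub_zero] at this
        exact this.trans hu)
    rw [intervalIntegral.integral_sub (hq.intervalIntegrable _ _) (by simp)] at h
    simpa using h
  have h1 := abs_le.1 (hest δ (abs_of_pos hδ).le)
  have h2 := abs_le.1 (hest (-δ) (by rw [abs_neg, abs_of_pos hδ]))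
  rw [abs_neg] at h2
  rw [abs_of_pos hδ] at h1 h2
  have h3 := abs_le.1 hσ
  have hmem : (0 : ℝ) ∈ Set.uIcc (σ + ∫ v in (0 : ℝ)..(-δ), q v)
      (σ + ∫ v in (0 : ℝ)..δ, q v) := by
    rw [Set.mem_uIcc]
    rcases abs_cases c with ⟨hc, -⟩ | ⟨hc, -⟩ <;> rw [hc] at h1 h2 h3
    · left; constructor <;> nlinarith
    · right; constructor <;> nlinarith
  obtain ⟨u, hu, hu0⟩ := intermediate_value_uIcc hcont.continuousOn hmem
  rw [Set.uIcc_of_le (by linarith)] at hu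
  exact ⟨u, abs_le.2 hu, hu0⟩

/-- Denisova's theorem: for a jointly continuous ergodic measure-preserving flow on a
compact metric space and a continuous `f` with zero mean, for a.e. `x` with `f x ≠ 0`
there is `t k → ∞` with `∫_0^{t k} f(T_s x) ds = 0` and `T_{t k} x → x`. -/
theorem denisova
    {X : Type*} [MetricSpace X] [CompactSpace X] [MeasurableSpace X] [BorelSpace X]
    (μ : Measure X) [IsProbabilityMeasure μ]
    (T : ℝ → X → X)
    (hT0 : T 0 = id)
    (hTadd : ∀ s t : ℝ, T (s + t) = T s ∘ T t)
    (hTcont : Continuous fun p : ℝ × X => T p.1 p.2)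
    (hTmp : ∀ t : ℝ, MeasurePreserving (T t) μ μ)
    (hTerg : ∀ E : Set X, MeasurableSet E → (∀ t : ℝ, T t ⁻¹' E =ᵐ[μ] E) →
      μ E = 0 ∨ μ E = 1)
    (f : X → ℝ) (hfc : Continuous f) (hf0 : ∫ x, f x ∂μ = 0) :
    ∀ᵐ x ∂μ, f x ≠ 0 →
      ∃ t : ℕ → ℝ, Tendsto t atTop atTop ∧
        (∀ k : ℕ, (∫ s in (0:ℝ)..(t k), f (T s x)) = 0) ∧
        Tendsto (fun k => T (t k) x) atTop (𝓝 x) := by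
  have hfT : Continuous fun p : X × ℝ => f (T p.2 p.1) :=
    hfc.comp (hTcont.comp continuous_swap)
  have hfTs : ∀ x, Continuous fun s => f (T s x) := fun x =>
    hfT.comp (Continuous.prodMk_right x)
  have hTt : ∀ t, Continuous (T t) := fun t => hTcont.comp (Continuous.prodMk_right t)
  let S (t : ℝ) : C(X, ℝ) := ⟨fun x => ∫ s in (0 : ℝ)..t, f (T s x),
    intervalIntegral.continuous_parametric_intervalIntegral_of_continuous' hfT 0 t⟩
  have hSapply : ∀ t x, S t x = ∫ s in (0 : ℝ)..t, f (T s x) := fun _ _ => rfl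
  have hS : ∀ s t x, S (s + t) x = S s x + S t (T s x) := by
    intro s t x
    simp only [hSapply]
    rw [← intervalIntegral.integral_add_adjacent_intervals
      ((hfTs x).intervalIntegrable 0 s) ((hfTs x).intervalIntegrable s (s + t))]
    congr 1
    have h := intervalIntegral.integral_comp_add_right (a := 0) (b := t)
      (fun v => f (T v x)) s
    rw [zero_add, add_comm t s] at h
    rw [← h]
    simp only [hTadd, Function.comp_apply]
  have hfcomp : ∀ t, ∫ x, f (T t x) ∂μ = 0 := by
    intro t
    have h := integral_map (hTmp t).aemeasurable (f := f) hfc.aestronglyMeasurable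
    rw [← h, (hTmp t).map_eq, hf0]
  have hS0 : ∀ t, ∫ x, S t x ∂μ = 0 := by
    intro t
    simp only [hSapply]
    have hSint : Integrable (Function.uncurry fun s x => f (T s x))
        ((volume.restrict (Set.uIoc 0 t)).prod μ) := by
      have : IsFiniteMeasure (volume.restrict (Set.uIoc 0 t)) := ⟨by simp [Set.uIoc]⟩
      have hc : Continuous (Function.uncurry fun s x => f (T s x)) := hfc.comp hTcont
      obtain ⟨C, hC⟩ := (isCompact_range hfc).isBounded.exists_norm_le
      exact .of_bound hc.aestronglyMeasurable C
        (Eventually.of_forall fun p => hC _ ⟨T p.1 p.2, rfl⟩)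
    rw [← intervalIntegral_integral_swap hSint]
    simp [hfcomp]
  have hrec : ∀ᵐ x ∂μ, ∀ M k : ℕ, ∃ n : ℕ, 1 ≤ n ∧
      dist (T (n * (M + 1 : ℝ)) x) x < 1 / (k + 1 : ℝ) ∧
      |S (n * (M + 1 : ℝ)) x| < 1 / (k + 1 : ℝ) := by
    refine ae_all_iff.2 fun M => ae_all_iff.2 fun k => ?_
    have hk : (0 : ℝ) < 1 / (k + 1 : ℝ) := Nat.one_div_pos_of_nat
    obtain ⟨D, hDc, hDd⟩ := TopologicalSpace.exists_countable_dense X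
    have hret : ∀ᵐ x ∂μ, ∀ d ∈ D, x ∈ Metric.ball d (1 / (k + 1 : ℝ) / 2) →
        ∃ n : ℕ, 1 ≤ n ∧ (T (M + 1 : ℝ))^[n] x ∈ Metric.ball d (1 / (k + 1 : ℝ) / 2) ∧
          |birkhoffSum (T (M + 1 : ℝ)) (S (M + 1 : ℝ)) n x| < 1 / (k + 1 : ℝ) :=
      (ae_ball_iff hDc).2 fun d _ => (hTmp _).ae_exists_return_birkhoffSum_lt
        (S _).continuous.measurable (((S _).memLp (p := 1) (μ := μ) ℝ).integrable le_rfl)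
        (tendsto_integral_abs_birkhoffAverage_cocycle hT0 hTadd hTt hTmp hTerg hS _ (hS0 _))
        Metric.isOpen_ball.measurableSet hk
    filter_upwards [hret] with x hx
    obtain ⟨d, hd, hxd⟩ := hDd.exists_dist_lt x (half_pos hk)
    obtain ⟨n, hn, hnd, hSn⟩ := hx d hd hxd
    rw [iterate_flow hT0 hTadd] at hnd
    rw [birkhoffSum_cocycle hT0 hTadd hS] at hSn
    refine ⟨n, hn, ?_, hSn⟩
    calc dist (T (n * (M + 1 : ℝ)) x) x ≤ dist (T (n * (M + 1 : ℝ)) x) d + dist x d :=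
          dist_triangle_right _ _ _
      _ < 1 / (k + 1 : ℝ) / 2 + 1 / (k + 1 : ℝ) / 2 := add_lt_add hnd hxd
      _ = 1 / (k + 1 : ℝ) := add_halves _
  filter_upwards [hrec] with x hx hfx
  have hchoose : ∀ k : ℕ, ∃ t : ℝ, (k : ℝ) ≤ t ∧ S t x = 0 ∧
      dist (T t x) x < 1 / (k + 1 : ℝ) := by
    intro k
    have hk : (0 : ℝ) < 1 / (k + 1 : ℝ) := Nat.one_div_pos_of_nat
    have hc : 0 < |f x| / 2 := by positivity
    have hTx : T 0 x = x := congrFun hT0 x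
    have h1 : ∀ᶠ p : ℝ × X in 𝓝 (0, x), dist (T p.1 p.2) x < 1 / (k + 1 : ℝ) := by
      have := hTcont.tendsto (0, x)
      simp only [hTx] at this
      exact this.eventually (Metric.ball_mem_nhds x hk)
    have h2 : ∀ᶠ p : ℝ × X in 𝓝 (0, x), |f (T p.1 p.2) - f x| < |f x| / 2 := by
      have := (hfc.comp hTcont).tendsto (0, x)
      simp only [Function.comp_apply, hTx] at this
      exact this.eventually (Metric.ball_mem_nhds (f x) hc)
    obtain ⟨r, hr, hball⟩ := Metric.eventually_nhds_iff.1 (h1.and h2)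
    set δ := min (r / 2) 1 with hδdef
    have hδ : 0 < δ := by positivity
    have hδr : δ < r := (min_le_left _ _).trans_lt (by linarith)
    obtain ⟨m, hm⟩ := exists_nat_one_div_lt (lt_min hr (mul_pos hc hδ))
    obtain ⟨n, hn, hd, hSn⟩ := hx k m
    have hnear : ∀ v, |v| ≤ δ → dist (v, T (n * (k + 1 : ℝ)) x) (0, x) < r := by
      intro v hv
      rw [Prod.dist_eq]
      refine max_lt ?_ (hd.trans (hm.trans_le (min_le_left _ _)))
      simpa using hv.trans_lt hδr
    obtain ⟨u, hu, hu0⟩ := exists_add_intervalIntegral_eq_zero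
      (hfTs (T (n * (k + 1 : ℝ)) x)) hδ (fun v hv => (hball (hnear v hv)).2.le)
      (hSn.le.trans (hm.le.trans (min_le_right _ _)))
    refine ⟨n * (k + 1) + u, ?_, ?_, ?_⟩
    · have hu1 : -1 ≤ u := by linarith [(abs_le.1 hu).1, min_le_right (r / 2) 1]
      have hn1 : (1 : ℝ) ≤ n := by exact_mod_cast hn
      nlinarith [(Nat.cast_nonneg k : (0 : ℝ) ≤ k)]
    · rw [hS]
      exact hu0
    · rw [add_comm, hTadd]
      exact (hball (hnear u hu)).1
  choose t ht1 ht2 ht3 using hchoose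
  refine ⟨t, tendsto_atTop_mono ht1 tendsto_natCast_atTop_atTop, ht2, ?_⟩
  exact tendsto_iff_dist_tendsto_zero.2 <| squeeze_zero (fun _ => dist_nonneg)
    (fun k => (ht3 k).le) tendsto_one_div_add_atTop_nhds_zero_nat
end

section
/- Let (X,μ) be a standard measure space with a sigma-finite measure μ, let (S_t)_{t∈ℝ} be a measurable measure-preserving flow on (X,μ), and let f : X → ℝ be integrable with ∫_X f dμ = 0. Suppose the time-one map S_1 is ergodic and conservative. Then the time-one map of the cylindrical flow, i.e. the transformation C_1 : X × ℝ → X × ℝ given by C_1(x,r) = (S_1 x, r + ∫_0^1 f(S_s x) ds), is conservative with respect to the product of μ with Lebesgue measure on ℝ. -/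
open MeasureTheory Filter

/-- The Garsia maximal functions of `g` along `T`: the `n`-th one is the maximum of the Birkhoff
sums of `g` of length at most `n`. -/
noncomputable def birkhoffMax {X : Type*} (T : X → X) (g : X → ℝ) : ℕ → X → ℝ
  | 0 => fun _ => 0
  | n + 1 => fun x => max 0 (g x + birkhoffMax T g n (T x))

section BirkhoffMax

variable {X : Type*} {T : X → X} {g : X → ℝ}

lemma birkhoffMax_succ (n : ℕ) (x : X) :
    birkhoffMax T g (n + 1) x = max 0 (g x + birkhoffMax T g n (T x)) := rfl

lemma birkhoffMax_nonneg (n : ℕ) (x : X) : 0 ≤ birkhoffMax T g n x := by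
  cases n with
  | zero => exact le_rfl
  | succ n => exact le_max_left _ _

lemma birkhoffMax_le_succ (n : ℕ) (x : X) :
    birkhoffMax T g n x ≤ birkhoffMax T g (n + 1) x := by
  induction n generalizing x with
  | zero => exact birkhoffMax_nonneg _ _
  | succ n ih =>
    rw [birkhoffMax_succ, birkhoffMax_succ (n + 1)]
    gcongr
    exact ih _

lemma monotone_birkhoffMax (x : X) : Monotone fun n => birkhoffMax T g n x :=
  monotone_nat_of_le_succ fun n => birkhoffMax_le_succ n x

lemma birkhoffSum_le_birkhoffMax (n : ℕ) (x : X) :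
    birkhoffSum T g n x ≤ birkhoffMax T g n x := by
  induction n generalizing x with
  | zero => simp [birkhoffMax]
  | succ n ih =>
    rw [birkhoffSum_succ', birkhoffMax_succ]
    exact le_max_of_le_right (by gcongr; exact ih _)

variable [MeasurableSpace X] {μ : Measure X}

lemma measurable_birkhoffMax (hT : Measurable T) (hg : Measurable g) (n : ℕ) :
    Measurable (birkhoffMax T g n) := by
  induction n with
  | zero => exact measurable_const
  | succ n ih => exact measurable_const.max (hg.add (ih.comp hT))

lemma integrable_birkhoffMax (hT : MeasurePreserving T μ μ) (hg : Integrable g μ) (n : ℕ) :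
    Integrable (birkhoffMax T g n) μ := by
  induction n with
  | zero => exact integrable_zero _ _ _
  | succ n ih => exact (integrable_zero _ _ _).sup (hg.add (hT.integrable_comp_of_integrable ih))

/-- The maximal ergodic inequality in the form used by Garsia. -/
lemma integral_max_neg_birkhoffMax_nonneg (hT : MeasurePreserving T μ μ) (hgm : Measurable g)
    (hg : Integrable g μ) (n : ℕ) :
    0 ≤ ∫ x, max (-birkhoffMax T g n (T x)) (g x) ∂μ := by
  have hM := integrable_birkhoffMax hT hg
  have h1 : ∀ x, max (-birkhoffMax T g n (T x)) (g x)
      = birkhoffMax T g (n + 1) x - birkhoffMax T g n (T x) := by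
    intro x
    rw [birkhoffMax_succ, ← max_sub_sub_right]
    simp
  have h2 : ∫ x, birkhoffMax T g n (T x) ∂μ = ∫ x, birkhoffMax T g n x ∂μ := by
    conv_rhs => rw [← hT.map_eq]
    rw [integral_map hT.measurable.aemeasurable
      (measurable_birkhoffMax hT.measurable hgm n).aestronglyMeasurable]
  simp_rw [h1]
  have hMT : Integrable (fun x => birkhoffMax T g n (T x)) μ :=
    hT.integrable_comp_of_integrable (hM n)
  rw [integral_sub (hM _) hMT, h2, sub_nonneg]
  exact integral_mono (hM _) (hM _) (birkhoffMax_le_succ n)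

/-- For an ergodic transformation, the Birkhoff sums of an integrable function with negative
integral are almost everywhere bounded above. -/
theorem ae_exists_forall_birkhoffSum_le (hT : MeasurePreserving T μ μ)
    (herg : ∀ E : Set X, MeasurableSet E → T ⁻¹' E =ᵐ[μ] E → μ E = 0 ∨ μ Eᶜ = 0)
    (hgm : Measurable g) (hg : Integrable g μ) (hneg : ∫ x, g x ∂μ < 0) :
    ∀ᵐ x ∂μ, ∃ C : ℝ, ∀ n, birkhoffSum T g n x ≤ C := by
  set E : Set X := {x | ∀ C : ℕ, ∃ n, (C : ℝ) < birkhoffMax T g n x} with hE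
  have hEm : MeasurableSet E := by
    have : E = ⋂ C : ℕ, ⋃ n, {x | (C : ℝ) < birkhoffMax T g n x} := by
      ext x; simp [hE]
    rw [this]
    exact .iInter fun C => .iUnion fun n =>
      measurableSet_lt measurable_const (measurable_birkhoffMax hT.measurable hgm n)
  have hinv : T ⁻¹' E = E := by
    ext x
    constructor
    · intro h C
      obtain ⟨K, hK⟩ := exists_nat_gt ((C : ℝ) - g x)
      obtain ⟨n, hn⟩ := h K
      exact ⟨n + 1, lt_max_of_lt_right (by linarith)⟩
    · intro h C
      obtain ⟨K, hK⟩ := exists_nat_gt (max 0 ((C : ℝ) + g x))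
      obtain ⟨n, hn⟩ := h K
      refine ⟨n, ?_⟩
      have hn' := hn.trans_le (birkhoffMax_le_succ n x)
      rw [birkhoffMax_succ] at hn'
      have h0 := (le_max_left _ _).trans_lt hK
      have h1 := (le_max_right _ _).trans_lt hK
      rcases lt_max_iff.1 hn' with h | h <;> linarith
  rcases herg E hEm (.of_eq hinv) with h | h
  · filter_upwards [measure_eq_zero_iff_ae_notMem.1 h] with x hx
    simp only [hE, Set.mem_ofPred_eq, not_forall, not_exists, not_lt] at hx
    obtain ⟨C, hC⟩ := hx
    exact ⟨C, fun n => (birkhoffSum_le_birkhoffMax n x).trans (hC n)⟩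
  · exfalso
    have hae : ∀ᵐ x ∂μ, x ∈ E := by
      rw [ae_iff]; exact h
    have hlim : Tendsto (fun n => ∫ x, max (-birkhoffMax T g n (T x)) (g x) ∂μ) atTop
        (nhds (∫ x, g x ∂μ)) := by
      refine tendsto_integral_of_dominated_convergence (fun x => |g x|) (fun n => ?_) hg.abs
        (fun n => ?_) ?_
      · exact (((measurable_birkhoffMax hT.measurable hgm n).comp hT.measurable).neg.max
          hgm).aestronglyMeasurable
      · refine .of_forall fun x => ?_
        rw [Real.norm_eq_abs, abs_le]
        exact ⟨(neg_abs_le _).trans (le_max_right _ _),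
          max_le ((neg_nonpos.2 (birkhoffMax_nonneg _ _)).trans (abs_nonneg _)) (le_abs_self _)⟩
      · filter_upwards [hae] with x hx
        rw [← hinv] at hx
        obtain ⟨K, hK⟩ := exists_nat_gt (-g x)
        obtain ⟨N, hN⟩ := hx K
        refine tendsto_const_nhds.congr' ?_
        filter_upwards [eventually_ge_atTop N] with n hn
        have := monotone_birkhoffMax (T := T) (g := g) (T x) hn
        dsimp only at this
        rw [max_eq_right (by linarith)]
    exact hneg.not_ge (ge_of_tendsto' hlim (integral_max_neg_birkhoffMax_nonneg hT hgm hg))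

end BirkhoffMax

/-- Birkhoff sums of a nonnegative function with a positive lower bound along infinitely many
iterates are unbounded. -/
lemma exists_lt_birkhoffSum_of_frequently {X : Type*} {T : X → X} {h : X → ℝ} (h0 : ∀ x, 0 ≤ h x)
    {δ : ℝ} (hδ : 0 < δ) {x : X} (hx : ∃ᶠ n in atTop, δ < h (T^[n] x)) (C : ℝ) :
    ∃ n, C < birkhoffSum T h n x := by
  have hmono : Monotone fun n => birkhoffSum T h n x :=
    monotone_nat_of_le_succ fun n => by
      rw [birkhoffSum_succ]; linarith [h0 (T^[n] x)]
  have key : ∀ k : ℕ, ∃ n, k * δ ≤ birkhoffSum T h n x := by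
    intro k
    induction k with
    | zero => exact ⟨0, by simp⟩
    | succ k ih =>
      obtain ⟨n, hn⟩ := ih
      obtain ⟨m, hm, hm'⟩ := frequently_atTop.1 hx n
      refine ⟨m + 1, ?_⟩
      have := hmono hm
      dsimp only at this
      rw [birkhoffSum_succ]
      push_cast
      linarith
  obtain ⟨k, hk⟩ := exists_nat_gt (C / δ)
  obtain ⟨n, hn⟩ := key k
  exact ⟨n, ((div_lt_iff₀ hδ).1 hk).trans_le hn⟩

/-- If the fibres of a set over the orbit of `x`, translated back by the cocycle, are essentially
disjoint and lie in `[-M, M]`, then the sum of their lengths is controlled by the size of the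
cocycle. -/
lemma sum_measureReal_fiber_le {X : Type*} {T : X → X} {φ : X → ℝ}
    {B : Set (X × ℝ)} {M D : ℝ} {x : X} {n : ℕ} (hMD : 0 ≤ M + D)
    (hBm : ∀ y, MeasurableSet (Prod.mk y ⁻¹' B))
    (hBM : ∀ p ∈ B, p.2 ∈ Set.Icc (-M) M)
    (hD : ∀ k < n, |birkhoffSum T φ k x| ≤ D)
    (hdisj : ∀ j m, 1 ≤ m → volume {r : ℝ | (T^[j] x, r) ∈ B ∧
      (T^[m] (T^[j] x), r + birkhoffSum T φ m (T^[j] x)) ∈ B} = 0) :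
    ∑ k ∈ Finset.range n, volume.real (Prod.mk (T^[k] x) ⁻¹' B) ≤ 2 * (M + D) := by
  set F : ℕ → Set ℝ := fun k =>
    (fun r => r + birkhoffSum T φ k x) ⁻¹' (Prod.mk (T^[k] x) ⁻¹' B) with hF
  have hFm : ∀ k, MeasurableSet (F k) := fun k => (measurable_add_const _) (hBm _)
  have hvol : ∀ k, volume (F k) = volume (Prod.mk (T^[k] x) ⁻¹' B) := fun k =>
    measure_preimage_add_right _ _ _
  have hlt : ∀ j k, j < k → volume (F j ∩ F k) = 0 := by
    intro j k hjk
    obtain ⟨m, rfl⟩ := Nat.exists_eq_add_of_lt hjk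
    have := hdisj j (m + 1) (by omega)
    rw [← measure_preimage_add_right volume (birkhoffSum T φ j x)] at this
    refine measure_mono_null ?_ this
    rintro r ⟨h1, h2⟩
    refine ⟨h1, ?_⟩
    simp only [hF, Set.mem_preimage] at h2
    rw [add_assoc j m 1, birkhoffSum_add, add_comm j, Function.iterate_add_apply,
      ← add_assoc] at h2
    exact h2
  have hsum : ∑ k ∈ Finset.range n, volume (F k) = volume (⋃ k ∈ Finset.range n, F k) := by
    refine (measure_biUnion_finset₀ ?_ fun k _ => (hFm k).nullMeasurableSet).symm
    intro j _ k _ hjk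
    rcases lt_or_gt_of_ne hjk with h | h
    · exact hlt j k h
    · change volume (F j ∩ F k) = 0
      rw [Set.inter_comm]; exact hlt k j h
  have hsub : (⋃ k ∈ Finset.range n, F k) ⊆ Set.Icc (-(M + D)) (M + D) := by
    refine Set.iUnion₂_subset fun k hk r hr => ?_
    have h1 := hBM _ hr
    have h2 := abs_le.1 (hD k (Finset.mem_range.1 hk))
    simp only [Set.mem_Icc] at h1 ⊢
    constructor <;> linarith
  have hle : ∑ k ∈ Finset.range n, volume (F k) ≤ ENNReal.ofReal (2 * (M + D)) := by
    rw [hsum]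
    refine (measure_mono hsub).trans_eq ?_
    rw [Real.volume_Icc]; congr 1; ring
  have hfin : ∀ k ∈ Finset.range n, volume (F k) ≠ ⊤ := fun k hk =>
    ((Finset.single_le_sum (f := fun k => volume (F k)) (fun _ _ => zero_le) hk).trans_lt
      (hle.trans_lt ENNReal.ofReal_lt_top)).ne
  simp_rw [Measure.real, ← hvol]
  rw [← ENNReal.toReal_sum hfin]
  exact ENNReal.toReal_le_of_le_ofReal (by linarith) hle

/-- Recurrence of real cocycles of zero mean, for a set of finite measure and bounded fibres. -/
theorem exists_return_of_bounded {X : Type*} [MeasurableSpace X] {μ : Measure X} [SigmaFinite μ]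
    {T : X → X} {φ : X → ℝ} (hT : MeasurePreserving T μ μ)
    (herg : ∀ E : Set X, MeasurableSet E → T ⁻¹' E =ᵐ[μ] E → μ E = 0 ∨ μ Eᶜ = 0)
    (hcons : Conservative T μ) (hφm : Measurable φ) (hφ : Integrable φ μ) (hφ0 : ∫ x, φ x ∂μ = 0)
    {B : Set (X × ℝ)} (hB : MeasurableSet B) (hpos : 0 < (μ.prod volume) B)
    (hfin : (μ.prod volume) B < ⊤) {M : ℝ} (hM : 0 ≤ M)
    (hBM : ∀ p ∈ B, p.2 ∈ Set.Icc (-M) M) :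
    ∃ n : ℕ, 1 ≤ n ∧ 0 < (μ.prod volume)
      (B ∩ {p | (T^[n] p.1, p.2 + birkhoffSum T φ n p.1) ∈ B}) := by
  by_contra! hcon
  set h : X → ℝ := fun x => volume.real (Prod.mk x ⁻¹' B) with hh
  have h0 : ∀ x, 0 ≤ h x := fun x => measureReal_nonneg
  have hhm : Measurable h := (measurable_measure_prodMk_left hB).ennreal_toReal
  have hhi : Integrable h μ := Measure.integrable_measure_prodMk_left hB hfin.ne
  have hfib : ∀ x, volume (Prod.mk x ⁻¹' B) ≠ ⊤ := fun x =>
    ((measure_mono (t := Set.Icc (-M) M) fun r hr => hBM _ hr).trans_lt measure_Icc_lt_top).ne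
  have hIpos : 0 < ∫ x, h x ∂μ := by
    rw [integral_pos_iff_support_of_nonneg h0 hhi, pos_iff_ne_zero]
    intro hz
    refine hpos.ne' ((Measure.measure_prod_null hB).2 ?_)
    filter_upwards [measure_eq_zero_iff_ae_notMem.1 hz] with x hx
    rw [Function.notMem_support] at hx
    exact (ENNReal.toReal_eq_zero_iff _).1 hx |>.resolve_right (hfib x)
  have hbound : ∀ ψ : X → ℝ, Measurable ψ → Integrable ψ μ → ∫ x, ψ x ∂μ = 0 →
      ∀ᵐ x ∂μ, ∃ C : ℝ, ∀ n, birkhoffSum T ψ n x ≤ C + birkhoffSum T h n x / 4 := by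
    intro ψ hψm hψ hψ0
    have := ae_exists_forall_birkhoffSum_le (g := fun x => ψ x - h x / 4) hT herg
      (hψm.sub (hhm.div_const 4)) (hψ.sub (hhi.div_const 4)) (by
        rw [integral_sub hψ (hhi.div_const 4), integral_div, hψ0]; linarith)
    filter_upwards [this] with x ⟨C, hC⟩
    refine ⟨C, fun n => ?_⟩
    have := hC n
    simp only [birkhoffSum, Finset.sum_sub_distrib, ← Finset.sum_div] at this ⊢
    linarith
  have hdisj : ∀ᵐ x ∂μ, ∀ j m, 1 ≤ m → volume {r : ℝ | (T^[j] x, r) ∈ B ∧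
      (T^[m] (T^[j] x), r + birkhoffSum T φ m (T^[j] x)) ∈ B} = 0 := by
    have h1 : ∀ᵐ x ∂μ, ∀ m, 1 ≤ m → volume {r : ℝ | (x, r) ∈ B ∧
        (T^[m] x, r + birkhoffSum T φ m x) ∈ B} = 0 := by
      refine ae_all_iff.2 fun m => ?_
      by_cases hm : 1 ≤ m
      · filter_upwards [Measure.measure_ae_null_of_prod_null (nonpos_iff_eq_zero.1 (hcon m hm))]
          with x hx _ using hx
      · exact .of_forall fun x h => absurd h hm
    exact ae_all_iff.2 fun j => (hT.iterate j).quasiMeasurePreserving.ae h1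
  have hbdd : ∀ᵐ x ∂μ, ∃ C : ℝ, ∀ n, birkhoffSum T h n x ≤ C := by
    filter_upwards [hdisj, hbound φ hφm hφ hφ0, hbound (fun x => -φ x) hφm.neg hφ.neg
      (by rw [integral_neg, hφ0, neg_zero])] with x hx ⟨C₁, hC₁⟩ ⟨C₂, hC₂⟩
    have hmono : Monotone fun n => birkhoffSum T h n x :=
      monotone_nat_of_le_succ fun n => by
        rw [birkhoffSum_succ]; linarith [h0 (T^[n] x)]
    have hnn : ∀ n, 0 ≤ birkhoffSum T h n x := fun n => Finset.sum_nonneg fun k _ => h0 _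
    set C := max C₁ C₂
    have hC0 : 0 ≤ C := by
      have := hC₁ 0
      simp only [birkhoffSum_zero] at this
      exact le_max_of_le_left (by linarith)
    refine ⟨4 * (M + C), fun n => ?_⟩
    have := sum_measureReal_fiber_le (T := T) (φ := φ) (B := B) (M := M)
      (D := C + birkhoffSum T h n x / 4) (x := x) (n := n) (by linarith [hnn n])
      (fun y => measurable_prodMk_left hB) hBM (fun k hk => ?_) hx
    · change birkhoffSum T h n x ≤ _ at this
      linarith
    · have h1 := hC₁ k
      have h2 := hC₂ k
      have h3 := hmono hk.le
      simp only [birkhoffSum, Finset.sum_neg_distrib] at h1 h2 h3 ⊢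
      have h4 : C₁ ≤ C := le_max_left _ _
      have h5 : C₂ ≤ C := le_max_right _ _
      exact abs_le.2 ⟨by linarith, by linarith⟩
  have hzero : ∀ᵐ x ∂μ, ∀ k : ℕ, ¬ 1 / ((k : ℝ) + 1) < h x := by
    refine ae_all_iff.2 fun k => ?_
    filter_upwards [hbdd, hcons.ae_mem_imp_frequently_image_mem
      (s := {x | 1 / ((k : ℝ) + 1) < h x})
      (measurableSet_lt measurable_const hhm).nullMeasurableSet] with x ⟨C, hC⟩ hx hlt
    obtain ⟨n, hn⟩ := exists_lt_birkhoffSum_of_frequently h0 (by positivity) (hx hlt) C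
    exact hn.not_ge (hC n)
  refine hIpos.ne' (integral_eq_zero_of_ae ?_)
  filter_upwards [hzero] with x hx
  by_contra hne
  obtain ⟨k, hk⟩ := exists_nat_one_div_lt ((h0 x).lt_of_ne' hne)
  exact hx k hk

/-- Recurrence of real cocycles of zero mean over conservative ergodic transformations. -/
theorem exists_return_of_integral_eq_zero {X : Type*} [MeasurableSpace X] {μ : Measure X}
    [SigmaFinite μ] {T : X → X} {φ : X → ℝ} (hT : MeasurePreserving T μ μ)
    (herg : ∀ E : Set X, MeasurableSet E → T ⁻¹' E =ᵐ[μ] E → μ E = 0 ∨ μ Eᶜ = 0)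
    (hcons : Conservative T μ) (hφm : Measurable φ) (hφ : Integrable φ μ) (hφ0 : ∫ x, φ x ∂μ = 0)
    {B : Set (X × ℝ)} (hB : MeasurableSet B) (hpos : 0 < (μ.prod volume) B) :
    ∃ n : ℕ, 1 ≤ n ∧ 0 < (μ.prod volume)
      (B ∩ {p | (T^[n] p.1, p.2 + birkhoffSum T φ n p.1) ∈ B}) := by
  obtain ⟨i, j, hij⟩ : ∃ i j : ℕ,
      0 < (μ.prod volume) (B ∩ spanningSets μ i ×ˢ Set.Icc (-(j : ℝ)) j) := by
    by_contra! hcon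
    refine hpos.ne' (measure_mono_null (t := ⋃ i : ℕ, ⋃ j : ℕ,
      B ∩ spanningSets μ i ×ˢ Set.Icc (-(j : ℝ)) j) (fun p hp => ?_) ?_)
    · obtain ⟨j, hj⟩ := exists_nat_ge |p.2|
      exact Set.mem_iUnion₂.2 ⟨_, j, hp, mem_spanningSetsIndex μ p.1, abs_le.1 hj⟩
    · exact measure_iUnion_null fun i => measure_iUnion_null fun j =>
        nonpos_iff_eq_zero.1 (hcon i j)
  obtain ⟨n, hn, hret⟩ := exists_return_of_bounded hT herg hcons hφm hφ hφ0
    (hB.inter ((measurableSet_spanningSets μ i).prod measurableSet_Icc)) hij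
    ((measure_mono Set.inter_subset_right).trans_lt (by
      rw [Measure.prod_prod]
      exact ENNReal.mul_lt_top (measure_spanningSets_lt_top μ i) measure_Icc_lt_top))
    j.cast_nonneg (fun p hp => hp.2.2)
  exact ⟨n, hn, hret.trans_le (measure_mono fun p hp => ⟨hp.1.1, hp.2.1⟩)⟩

/-- Iterates of a skew product are given by Birkhoff sums of its cocycle. -/
lemma iterate_skewProduct {X : Type*} (T : X → X) (φ : X → ℝ) (n : ℕ) (p : X × ℝ) :
    (fun p : X × ℝ => (T p.1, p.2 + φ p.1))^[n] p
      = (T^[n] p.1, p.2 + birkhoffSum T φ n p.1) := by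
  induction n with
  | zero => simp
  | succ n ih =>
    rw [Function.iterate_succ_apply', ih, Function.iterate_succ_apply', birkhoffSum_succ,
      add_assoc]

/-- Under a measure-preserving flow, a point `S s x` with `s` uniform in `(0, 1]` and `x`
distributed according to `μ` is again distributed according to `μ`. -/
lemma measurePreserving_flow_unitInterval {X : Type*} [MeasurableSpace X] {μ : Measure X}
    [SigmaFinite μ] {S : ℝ → X → X} (hSmp : ∀ t : ℝ, MeasurePreserving (S t) μ μ)
    (hSmeas : Measurable fun p : ℝ × X => S p.1 p.2) :
    MeasurePreserving (fun p : ℝ × X => S p.1 p.2)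
      ((volume.restrict (Set.Ioc (0 : ℝ) 1)).prod μ) μ := by
  have : IsProbabilityMeasure (volume.restrict (Set.Ioc (0 : ℝ) 1)) := ⟨by simp⟩
  exact measurePreserving_snd.comp
    ((MeasurePreserving.id (volume.restrict (Set.Ioc (0 : ℝ) 1))).skew_product hSmeas
      (.of_forall fun t => (hSmp t).map_eq))

/-- If the time-one map of a measurable measure-preserving flow on a standard
sigma-finite measure space is ergodic and conservative, and `f` is integrable with
zero mean, then the time-one map of the cylindrical flow,
`C₁(x, r) = (S₁ x, r + ∫_0^1 f(S_s x) ds)`, is conservative for `μ × Lebesgue`. -/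
theorem cylindrical_flow_time_one_conservative
    {X : Type*} [MeasurableSpace X] [StandardBorelSpace X]
    (μ : Measure X) [SigmaFinite μ]
    (S : ℝ → X → X)
    (hS0 : S 0 = id)
    (hSadd : ∀ s t : ℝ, S (s + t) = S s ∘ S t)
    (hSmp : ∀ t : ℝ, MeasurePreserving (S t) μ μ)
    (hSmeas : Measurable fun p : ℝ × X => S p.1 p.2)
    (hS1erg : ∀ E : Set X, MeasurableSet E → (S 1) ⁻¹' E =ᵐ[μ] E →
      μ E = 0 ∨ μ Eᶜ = 0)
    (hS1cons : ∀ B : Set X, MeasurableSet B → 0 < μ B →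
      ∃ n : ℕ, 1 ≤ n ∧ 0 < μ (B ∩ (S 1)^[n] ⁻¹' B))
    (f : X → ℝ) (hf : Integrable f μ) (hf0 : ∫ x, f x ∂μ = 0) :
    ∀ B : Set (X × ℝ), MeasurableSet B → 0 < (μ.prod volume) B →
      ∃ n : ℕ, 1 ≤ n ∧
        0 < (μ.prod volume)
          (B ∩ ((fun p : X × ℝ =>
            (S 1 p.1, p.2 + ∫ s in (0:ℝ)..1, f (S s p.1)))^[n]) ⁻¹' B) := by
  have hmp := measurePreserving_flow_unitInterval hSmp hSmeas
  have hfS : Integrable (fun p : ℝ × X => f (S p.1 p.2))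
      ((volume.restrict (Set.Ioc (0 : ℝ) 1)).prod μ) := hmp.integrable_comp_of_integrable hf
  set φ : X → ℝ := fun x => ∫ s in (0:ℝ)..1, f (S s x) with hφdef
  have hφeq : φ = fun x => ∫ s in Set.Ioc (0:ℝ) 1, f (S s x) := by
    funext x
    exact intervalIntegral.integral_of_le zero_le_one
  have hφ : Integrable φ μ := by
    rw [hφeq]
    exact hfS.integral_prod_right
  have hφ0 : ∫ x, φ x ∂μ = 0 := by
    rw [hφeq, ← integral_prod_symm _ hfS,
      ← integral_map (f := f) hmp.measurable.aemeasurable (by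
        rw [hmp.map_eq]; exact hf.aestronglyMeasurable), hmp.map_eq, hf0]
  have hcons : Conservative (S 1) μ :=
    { (hSmp 1).quasiMeasurePreserving with
      exists_mem_iterate_mem' := fun s hs hs0 => by
        obtain ⟨n, hn, hpos⟩ := hS1cons s hs (pos_iff_ne_zero.2 hs0)
        obtain ⟨x, hx, hx'⟩ := nonempty_of_measure_ne_zero hpos.ne'
        exact ⟨x, hx, n, by omega, hx'⟩ }
  obtain ⟨ψ, hψm, hψ⟩ := hφ.aestronglyMeasurable.aemeasurable
  intro B hB hpos
  obtain ⟨n, hn, hret⟩ := exists_return_of_integral_eq_zero (hSmp 1) hS1erg hcons hψm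
    (hφ.congr hψ) (by rw [← integral_congr_ae hψ, hφ0]) hB hpos
  refine ⟨n, hn, hret.trans_eq (measure_congr ?_)⟩
  have hsum : ∀ᵐ x ∂μ, birkhoffSum (S 1) φ n x = birkhoffSum (S 1) ψ n x := by
    have h : ∀ᵐ x ∂μ, ∀ k, φ ((S 1)^[k] x) = ψ ((S 1)^[k] x) :=
      ae_all_iff.2 fun k => ((hSmp 1).iterate k).quasiMeasurePreserving.ae hψ
    filter_upwards [h] with x hx
    exact Finset.sum_congr rfl fun k _ => hx k
  filter_upwards [Measure.quasiMeasurePreserving_fst.ae hsum] with p hp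
  refine propext (and_congr_right fun _ => ?_)
  rw [Set.mem_preimage, iterate_skewProduct (S 1) φ, hp]
  rfl
end
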